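/- arXiv:2102.05163 — 3 statements merged into one kernel-verified Lean document; each statement's English description precedes it below -/
import Mathlib

section
/- Let A be a finite nonempty set, B ⊆ A, and R ⊆ A × A a symmetric relation, with (σ_i) i.i.d. uniform on A, δ = P((σ₁,σ₂) ∈ R), q = P(σ₁ ∉ B), and E_k as above. Then for each k with 1 ≤ k ≤ q²/(4δ) - 1, the conditional probability satisfies P(E_{k+1} | E_k) ≥ q - 2kδ/q, provided P(E_k) > 0. -/
open MeasureTheory ProbabilityTheory

noncomputable section

/-- The event that the first `n` samples all avoid `B` and are pairwise unrelated under `R`. -/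
def Epack {α : Type*} {k : ℕ} (B : Finset α) (R : α → α → Prop) (n : ℕ) :
    Set (Fin (k + 1) → α) :=
  {x | (∀ i : Fin (k + 1), (i : ℕ) < n → x i ∉ B) ∧
    ∀ i j : Fin (k + 1), (i : ℕ) < n → (j : ℕ) < n → i ≠ j → ¬ R (x i) (x j)}

section Packing

variable {ι α : Type*}

/-- The samples indexed by `S` all lie in `N` and are pairwise unrelated under `r`. -/
def packSet (N : Set α) (r : α → α → Prop) (S : Finset ι) : Set (ι → α) :=
  {x | (∀ i ∈ S, x i ∈ N) ∧ ∀ i ∈ S, ∀ j ∈ S, i ≠ j → ¬ r (x i) (x j)}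

lemma packSet_anti (N : Set α) (r : α → α → Prop) {S T : Finset ι} (h : S ⊆ T) :
    packSet N r T ⊆ packSet N r S :=
  fun _ hx => ⟨fun i hi => hx.1 i (h hi), fun i hi j hj => hx.2 i (h hi) j (h hj)⟩

lemma packSet_eq_restrict_preimage (N : Set α) (r : α → α → Prop) (S : Finset ι) :
    packSet N r S =
      (fun (x : ι → α) (i : S) => x i) ⁻¹' packSet N r (Finset.univ : Finset S) := by
  ext x
  simp [packSet]

variable [MeasurableSpace α]

lemma measurableSet_packSet [Countable ι] {N : Set α} {r : α → α → Prop} (hN : MeasurableSet N)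
    (hr : MeasurableSet {p : α × α | r p.1 p.2}) (S : Finset ι) :
    MeasurableSet (packSet N r S) := by
  have h (i j : ι) : MeasurableSet {x : ι → α | r (x i) (x j)} :=
    MeasurableSet.preimage (f := fun x : ι → α => (x i, x j)) hr
      ((measurable_pi_apply i).prodMk (measurable_pi_apply j))
  have h1 (i : ι) : MeasurableSet {x : ι → α | x i ∈ N} := measurable_pi_apply i hN
  simp only [packSet, Set.ofPred_and, Set.ofPred_forall]
  exact (MeasurableSet.iInter fun i => .iInter fun _ => h1 i).inter
    (.iInter fun i => .iInter fun _ => .iInter fun j => .iInter fun _ => .iInter fun _ =>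
      (h i j).compl)

variable [Fintype ι] {μ : Measure α} [IsProbabilityMeasure μ] {N : Set α} {r : α → α → Prop}

lemma iIndepFun_eval_pi :
    iIndepFun (fun (i : ι) (x : ι → α) => x i) (Measure.pi fun _ : ι => μ) :=
  iIndepFun_pi (X := fun _ a => a) fun _ => aemeasurable_id

lemma map_eval_pair_pi {i j : ι} (hij : i ≠ j) :
    (Measure.pi fun _ : ι => μ).map (fun x => (x i, x j)) = μ.prod μ := by
  have h := (indepFun_iff_map_prod_eq_prod_map_map (measurable_pi_apply i).aemeasurable
    (measurable_pi_apply j).aemeasurable).1 ((iIndepFun_eval_pi (μ := μ)).indepFun hij)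
  rw [h]
  congr 1
  · exact (measurePreserving_eval (fun _ : ι => μ) i).map_eq
  · exact (measurePreserving_eval (fun _ : ι => μ) j).map_eq

lemma pi_real_packSet_inter_restrict_preimage [DecidableEq ι] (hN : MeasurableSet N)
    (hr : MeasurableSet {p : α × α | r p.1 p.2}) {S T : Finset ι} (hST : Disjoint S T)
    {t : Set (T → α)} (ht : MeasurableSet t) :
    (Measure.pi fun _ : ι => μ).real
        (packSet N r S ∩ (fun (x : ι → α) (i : T) => x i) ⁻¹' t) =
      (Measure.pi fun _ : ι => μ).real (packSet N r S) *
        (Measure.pi fun _ : ι => μ).real ((fun (x : ι → α) (i : T) => x i) ⁻¹' t) := by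
  have h := ((iIndepFun_eval_pi (μ := μ)).indepFun_finset S T hST
    measurable_pi_apply).measure_inter_preimage_eq_mul _ t
    (measurableSet_packSet hN hr (Finset.univ : Finset S)) ht
  rw [← packSet_eq_restrict_preimage] at h
  simp [Measure.real, h]

lemma pi_real_packSet_inter_mem [DecidableEq ι] (hN : MeasurableSet N)
    (hr : MeasurableSet {p : α × α | r p.1 p.2}) {S : Finset ι} {j : ι} (hj : j ∉ S) :
    (Measure.pi fun _ : ι => μ).real (packSet N r S ∩ {x | x j ∈ N}) =
      (Measure.pi fun _ : ι => μ).real (packSet N r S) * μ.real N := by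
  have h := pi_real_packSet_inter_restrict_preimage (μ := μ) hN hr
    (Finset.disjoint_singleton_right.2 hj)
    (measurable_pi_apply (⟨j, Finset.mem_singleton_self j⟩ : ({j} : Finset ι)) hN)
  have hm := (measurePreserving_eval (fun _ : ι => μ) j).measure_preimage hN.nullMeasurableSet
  have hm' : (Measure.pi fun _ : ι => μ).real {x | x j ∈ N} = μ.real N :=
    congrArg ENNReal.toReal hm
  rw [← hm']
  exact h

lemma pi_real_packSet_inter_rel [DecidableEq ι] (hN : MeasurableSet N)
    (hr : MeasurableSet {p : α × α | r p.1 p.2}) {S : Finset ι} {i j : ι} (hi : i ∉ S)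
    (hj : j ∉ S) (hij : i ≠ j) :
    (Measure.pi fun _ : ι => μ).real (packSet N r S ∩ {x | r (x i) (x j)}) =
      (Measure.pi fun _ : ι => μ).real (packSet N r S) *
        (μ.prod μ).real {p | r p.1 p.2} := by
  have h := pi_real_packSet_inter_restrict_preimage (μ := μ) (S := S) (T := {i, j}) hN hr
    (by simp [hi, hj])
    (measurableSet_preimage ((measurable_pi_apply (⟨i, by simp⟩ : ({i, j} : Finset ι))).prodMk
      (measurable_pi_apply (⟨j, by simp⟩ : ({i, j} : Finset ι)))) hr)
  have hm : (Measure.pi fun _ : ι => μ).real {x | r (x i) (x j)} =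
      (μ.prod μ).real {p | r p.1 p.2} := by
    rw [← map_eval_pair_pi (μ := μ) hij, map_measureReal_apply
      ((measurable_pi_apply i).prodMk (measurable_pi_apply j)) hr]
    rfl
  rw [← hm]
  exact h

/-- One step of the greedy packing argument, with the conflict between `j` and `i ∈ S` bounded
through the packing event of `S.erase i`. -/
lemma pi_real_packSet_insert_ge_sub_sum [DecidableEq ι] (hN : MeasurableSet N)
    (hr : MeasurableSet {p : α × α | r p.1 p.2}) (hs : ∀ a b, r a b → r b a)
    {S : Finset ι} {j : ι} (hj : j ∉ S) :
    (Measure.pi fun _ : ι => μ).real (packSet N r S) * μ.real N -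
        ∑ i ∈ S, (Measure.pi fun _ : ι => μ).real (packSet N r (S.erase i)) *
          (μ.prod μ).real {p | r p.1 p.2} ≤
      (Measure.pi fun _ : ι => μ).real (packSet N r (insert j S)) := by
  set ν := Measure.pi fun _ : ι => μ
  have hsub : packSet N r S ∩ {x | x j ∈ N} ⊆ packSet N r (insert j S) ∪
      ⋃ i ∈ S, packSet N r (S.erase i) ∩ {x | r (x i) (x j)} := by
    rintro x ⟨hx, hxj⟩
    by_cases h : ∃ i ∈ S, r (x i) (x j)
    · obtain ⟨i, hi, hrij⟩ := h
      exact Or.inr (Set.mem_biUnion hi ⟨packSet_anti N r (S.erase_subset i) hx, hrij⟩)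
    · push Not at h
      refine Or.inl ⟨fun i hi => ?_, fun a ha b hb hab => ?_⟩
      · rcases Finset.mem_insert.1 hi with rfl | hi
        exacts [hxj, hx.1 i hi]
      · rcases Finset.mem_insert.1 ha with rfl | ha' <;>
          rcases Finset.mem_insert.1 hb with rfl | hb'
        · exact absurd rfl hab
        · exact fun hrab => h b hb' (hs _ _ hrab)
        · exact h a ha'
        · exact hx.2 a ha' b hb' hab
  have hsum : ∑ i ∈ S, ν.real (packSet N r (S.erase i) ∩ {x | r (x i) (x j)}) =
      ∑ i ∈ S, ν.real (packSet N r (S.erase i)) * (μ.prod μ).real {p | r p.1 p.2} :=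
    Finset.sum_congr rfl fun i hi => pi_real_packSet_inter_rel hN hr (S.notMem_erase i)
      (fun h => hj (Finset.mem_of_mem_erase h)) (fun h => hj (h ▸ hi))
  rw [← pi_real_packSet_inter_mem hN hr hj, ← hsum, sub_le_iff_le_add]
  calc ν.real (packSet N r S ∩ {x | x j ∈ N})
      ≤ ν.real (packSet N r (insert j S) ∪
          ⋃ i ∈ S, packSet N r (S.erase i) ∩ {x | r (x i) (x j)}) := measureReal_mono hsub
    _ ≤ _ := (measureReal_union_le _ _).trans
        (add_le_add le_rfl (measureReal_biUnion_finset_le _ _))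

lemma pi_real_packSet_insert_ge [DecidableEq ι] (hN : MeasurableSet N)
    (hr : MeasurableSet {p : α × α | r p.1 p.2}) (hs : ∀ a b, r a b → r b a)
    (hq : 0 < μ.real N) (S : Finset ι) {j : ι} (hj : j ∉ S)
    (hS : 4 * S.card * (μ.prod μ).real {p | r p.1 p.2} ≤ μ.real N ^ 2) :
    (μ.real N - 2 * S.card * (μ.prod μ).real {p | r p.1 p.2} / μ.real N) *
        (Measure.pi fun _ : ι => μ).real (packSet N r S) ≤
      (Measure.pi fun _ : ι => μ).real (packSet N r (insert j S)) := by
  induction S using Finset.strongInduction generalizing j with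
  | H S ih =>
    refine le_trans ?_ (pi_real_packSet_insert_ge_sub_sum hN hr hs hj)
    set ν := Measure.pi fun _ : ι => μ
    set q := μ.real N
    set δ := (μ.prod μ).real {p | r p.1 p.2}
    have hδ : 0 ≤ δ := measureReal_nonneg
    have key : ∀ i ∈ S, ν.real (packSet N r (S.erase i)) * δ ≤
        2 * δ / q * ν.real (packSet N r S) := by
      intro i hi
      have hcard : ((S.erase i).card : ℝ) ≤ S.card := by
        exact_mod_cast Finset.card_le_card (S.erase_subset i)
      have hle : 4 * (S.erase i).card * δ ≤ q ^ 2 :=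
        le_trans (by gcongr) hS
      have h := ih _ (Finset.erase_ssubset hi) (S.notMem_erase i) hle
      rw [Finset.insert_erase hi] at h
      have hhalf : q / 2 ≤ q - 2 * (S.erase i).card * δ / q := by
        have : 2 * (S.erase i).card * δ / q ≤ q / 2 := by
          rw [div_le_iff₀ hq]
          linarith
        linarith
      have h2 : q / 2 * ν.real (packSet N r (S.erase i)) ≤ ν.real (packSet N r S) :=
        (mul_le_mul_of_nonneg_right hhalf measureReal_nonneg).trans h
      calc ν.real (packSet N r (S.erase i)) * δ
          = 2 * δ / q * (q / 2 * ν.real (packSet N r (S.erase i))) := by field_simp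
        _ ≤ _ := mul_le_mul_of_nonneg_left h2 (by positivity)
    have hsum := Finset.sum_le_sum key
    rw [Finset.sum_const, nsmul_eq_mul] at hsum
    calc _ = ν.real (packSet N r S) * q -
          S.card * (2 * δ / q * ν.real (packSet N r S)) := by ring
      _ ≤ _ := by linarith

end Packing

theorem stmt7 {α : Type*} [MeasurableSpace α] [MeasurableSingletonClass α]
    (A : Finset α) (hA : A.Nonempty) (B : Finset α) (hB : B ⊆ A)
    (R : α → α → Prop) (hR : Symmetric R) :
    ∀ (μ : Measure α), μ = (PMF.uniformOfFinset A hA).toMeasure →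
    ∀ (δ q : ℝ), δ = ((μ.prod μ) {p : α × α | R p.1 p.2}).toReal →
      q = (μ {a | a ∉ B}).toReal → 0 < δ →
    ∀ k : ℕ, 1 ≤ k → (k : ℝ) ≤ q ^ 2 / (4 * δ) - 1 →
    ∀ (ν : Measure (Fin (k + 1) → α)), ν = Measure.pi (fun _ => μ) →
      0 < (ν (Epack B R k)).toReal →
      q - 2 * k * δ / q ≤ ((ν[|Epack B R k]) (Epack B R (k + 1))).toReal := by
  classical
  rintro μ hμ δ q hδ hq hδ0 k - hk ν hν hpos
  have : IsProbabilityMeasure μ := hμ ▸ PMF.toMeasure.isProbabilityMeasure _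
  have hN : MeasurableSet {a | a ∉ B} := B.measurableSet.compl
  have hA_ae : ∀ᵐ a ∂μ, a ∈ A := by
    rw [hμ, ae_iff]
    refine (PMF.toMeasure_apply_eq_zero_iff _ A.measurableSet.compl).2 ?_
    exact Set.disjoint_left.2 fun a ha ha' => ha' (by simpa using ha)
  set r : α → α → Prop := fun a b => R a b ∧ a ∈ A ∧ b ∈ A with hr_def
  have hr : MeasurableSet {p : α × α | r p.1 p.2} := by
    refine ((A ×ˢ A).finite_toSet.subset fun p hp => ?_).measurableSet
    simpa using hp.2
  have hs : ∀ a b, r a b → r b a := fun a b h => ⟨hR h.1, h.2.2, h.2.1⟩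
  have hδ' : (μ.prod μ).real {p | r p.1 p.2} = δ := by
    rw [hδ]
    refine congrArg ENNReal.toReal (measure_congr ?_)
    filter_upwards [Measure.quasiMeasurePreserving_fst.ae hA_ae,
      Measure.quasiMeasurePreserving_snd.ae hA_ae] with p h1 h2
    exact propext ⟨fun h => h.1, fun h => ⟨h, h1, h2⟩⟩
  have hE (n : ℕ) : (Epack B R n : Set (Fin (k + 1) → α)) =ᵐ[ν]
      packSet {a | a ∉ B} r (Finset.univ.filter fun i : Fin (k + 1) => (i : ℕ) < n) := by
    have hall : ∀ᵐ x ∂ν, ∀ i, x i ∈ A := by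
      rw [ae_all_iff, hν]
      exact fun i => (measurePreserving_eval (fun _ : Fin (k + 1) => μ) i).quasiMeasurePreserving.ae
        hA_ae
    filter_upwards [hall] with x hx
    refine propext ?_
    change x ∈ Epack B R n ↔ x ∈ packSet _ _ _
    simp only [Epack, packSet, Set.mem_ofPred_eq, Finset.mem_filter, Finset.mem_univ, true_and,
      hr_def, hx, and_true]
    exact and_congr_right fun _ => ⟨fun h i hi j hj => h i j hi hj, fun h i j hi hj => h i hi j hj⟩
  set S : Finset (Fin (k + 1)) := Finset.univ.filter fun i => (i : ℕ) < k
  have hj : Fin.last k ∉ S := by simp [S]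
  have hins : (Finset.univ.filter fun i : Fin (k + 1) => (i : ℕ) < k + 1) =
      insert (Fin.last k) S := by
    ext i
    simp [S, Fin.ext_iff]
    lia
  have hcard : S.card ≤ k := by
    have := Finset.card_le_univ (insert (Fin.last k) S)
    rw [Finset.card_insert_of_notMem hj, Fintype.card_fin] at this
    lia
  have hcard' : (S.card : ℝ) ≤ k := by exact_mod_cast hcard
  have hkq : 4 * (k : ℝ) * δ + 4 * δ ≤ q ^ 2 := by
    have h : (k : ℝ) + 1 ≤ q ^ 2 / (4 * δ) := by linarith
    rw [le_div_iff₀ (by positivity)] at h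
    linarith
  have hq0 : 0 < q := by
    have h0 : 0 ≤ q := hq ▸ ENNReal.toReal_nonneg
    refine h0.lt_of_ne fun h => ?_
    rw [← h] at hkq
    have : 0 ≤ (k : ℝ) * δ := by positivity
    linarith
  have hq' : μ.real {a | a ∉ B} = q := hq.symm
  have hSq : 4 * (S.card : ℝ) * δ ≤ q ^ 2 := by
    have : 4 * (S.card : ℝ) * δ ≤ 4 * k * δ := by gcongr
    linarith
  have main := pi_real_packSet_insert_ge (μ := μ) hN hr hs (hq' ▸ hq0) S hj
    (by rw [hδ', hq']; exact hSq)
  rw [hδ', hq', ← hν] at main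
  have hcond : ν[|Epack B R k] = ν[|packSet {a | a ∉ B} r S] := by
    rw [ProbabilityTheory.cond, ProbabilityTheory.cond, measure_congr (hE k),
      Measure.restrict_congr_set (hE k)]
  have hE' := hE (k + 1)
  rw [hins] at hE'
  rw [measure_congr (cond_absolutelyContinuous.ae_le hE'), hcond,
    cond_apply (measurableSet_packSet hN hr S),
    Set.inter_eq_right.2 (packSet_anti _ _ (Finset.subset_insert _ _)), ENNReal.toReal_mul,
    ENNReal.toReal_inv]
  rw [measure_congr (hE k)] at hpos
  rw [inv_mul_eq_div, le_div_iff₀ hpos]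
  refine le_trans (mul_le_mul_of_nonneg_right ?_ hpos.le) main
  gcongr


end
end

section
/- For every κ > 0 there exist constants c_κ > 0 and C > 0 such that the following holds for all m ∈ ℕ: if (X₁,...,X_m) is a centered Gaussian vector with E[X_i²] = 1 and |E[X_i X_j]| ≤ c_κ/m for i ≠ j, then P(max_{1≤i≤m} |X_i| ≤ κ) ≤ C · P(|Z| ≤ κ)^m, where Z is a standard Gaussian. -/
open MeasureTheory ProbabilityTheory

noncomputable section

/-- `μ` is the law of a centered Gaussian vector with covariance matrix `Cov`:
every linear functional pushes `μ` forward to the corresponding real Gaussian law. -/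
def IsCenteredGaussianVec {m : ℕ} (μ : Measure (Fin m → ℝ))
    (Cov : Matrix (Fin m) (Fin m) ℝ) : Prop :=
  IsProbabilityMeasure μ ∧
    ∀ t : Fin m → ℝ,
      μ.map (fun x => ∑ i, t i * x i) =
        gaussianReal 0 (Real.toNNReal (∑ i, ∑ j, t i * Cov i j * t j))

theorem withDensity_pi {ι : Type*} [Fintype ι] {f : ι → ℝ → ℝ}
    (hf : ∀ i, 0 ≤ f i) (hfi : ∀ i, Integrable (f i)) :
    Measure.pi (fun i => (volume : Measure ℝ).withDensity fun x => ENNReal.ofReal (f i x)) =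
      (volume : Measure (ι → ℝ)).withDensity fun x => ENNReal.ofReal (∏ i, f i (x i)) := by
  have : ∀ i, IsFiniteMeasure
      ((volume : Measure ℝ).withDensity fun x => ENNReal.ofReal (f i x)) := fun i =>
    isFiniteMeasure_withDensity_ofReal (hfi i).2
  refine Measure.pi_eq fun s hs => ?_
  rw [withDensity_apply _ (MeasurableSet.univ_pi hs)]
  have h0 : ∀ i, (volume : Measure ℝ).withDensity (fun x => ENNReal.ofReal (f i x)) (s i) =
      ∫⁻ x in s i, ENNReal.ofReal (f i x) := fun i => withDensity_apply _ (hs i)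
  have h1 : ∀ i, ∫⁻ x in s i, ENNReal.ofReal (f i x) =
      ENNReal.ofReal (∫ x, f i x ∂(volume.restrict (s i))) := fun i =>
    (ofReal_integral_eq_lintegral_ofReal (hfi i).integrableOn (ae_of_all _ (hf i))).symm
  simp_rw [h0, h1]
  rw [← ENNReal.ofReal_prod_of_nonneg fun i _ => integral_nonneg (hf i),
    ← integral_fintype_prod_eq_prod, ← Measure.restrict_pi_pi, volume_pi,
    ofReal_integral_eq_lintegral_ofReal]
  · rw [Measure.restrict_pi_pi]
    exact Integrable.fintype_prod fun i => (hfi i).integrableOn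
  · exact ae_of_all _ fun x => Finset.prod_nonneg fun i _ => hf i _

theorem sum_exp_sign_le {ι : Type*} [Fintype ι] [DecidableEq ι]
    (w : ι × ι → ℝ) (b : ι × ι → ℝ) (h : ∀ p, |w p| ≤ b p) :
    ∑ ε : ι → ℤˣ, Real.exp (∑ p, w p * (((ε p.1 : ℤ) : ℝ) * ((ε p.2 : ℤ) : ℝ))) ≤
      ∑ ε : ι → ℤˣ, Real.exp (∑ p, b p * (((ε p.1 : ℤ) : ℝ) * ((ε p.2 : ℤ) : ℝ))) := by
  classical
  let χ : ι × ι → (ι → ℤˣ) →* ℝ := fun p =>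
    { toFun := fun ε => ((ε p.1 : ℤ) : ℝ) * ((ε p.2 : ℤ) : ℝ)
      map_one' := by simp
      map_mul' := fun x y => by simp; ring }
  have hχ : ∀ p ε, χ p ε = 1 ∨ χ p ε = -1 := by
    intro p ε
    simp only [χ, MonoidHom.coe_mk, OneHom.coe_mk]
    rcases Int.units_eq_one_or (ε p.1) with h1 | h1 <;>
      rcases Int.units_eq_one_or (ε p.2) with h2 | h2 <;> simp [h1, h2]
  have key : ∀ v : ι × ι → ℝ, ∑ ε : ι → ℤˣ, Real.exp (∑ p, v p * χ p ε) =
      ∑ T ∈ (Finset.univ : Finset (ι × ι)).powerset,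
        ((∏ p ∈ T, Real.sinh (v p)) * ∏ p ∈ Finset.univ \ T, Real.cosh (v p)) *
          ∑ ε : ι → ℤˣ, (∏ p ∈ T, χ p) ε := by
    intro v
    have : ∀ ε, Real.exp (∑ p, v p * χ p ε) =
        ∏ p, (Real.sinh (v p) * χ p ε + Real.cosh (v p)) := by
      intro ε
      rw [Real.exp_sum]
      refine Finset.prod_congr rfl fun p _ => ?_
      rcases hχ p ε with h | h
      · rw [h, mul_one, mul_one, Real.sinh_add_cosh]
      · rw [h, mul_neg_one, mul_neg_one, ← Real.cosh_sub_sinh]; ring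
    simp_rw [this, Finset.prod_add, Finset.mul_sum]
    rw [Finset.sum_comm]
    refine Finset.sum_congr rfl fun T _ => Finset.sum_congr rfl fun ε _ => ?_
    rw [Finset.prod_mul_distrib, MonoidHom.finsetProd_apply]
    ring
  refine (key w).le.trans (le_trans ?_ (key b).ge)
  refine Finset.sum_le_sum fun T _ => mul_le_mul_of_nonneg_right ?_ ?_
  · refine (le_abs_self _).trans ?_
    rw [abs_mul, Finset.abs_prod, Finset.abs_prod]
    have hs : ∀ p, |Real.sinh (w p)| ≤ Real.sinh (b p) := fun p => by
      rw [Real.abs_sinh]; exact Real.sinh_le_sinh.2 (h p)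
    gcongr with p _ p _ p _
    · exact Finset.prod_nonneg fun p _ => (abs_nonneg _).trans (hs p)
    · exact hs p
    · rw [abs_of_pos (Real.cosh_pos _)]; exact Real.cosh_le_cosh.2 ((h p).trans (le_abs_self _))
  · rw [sum_hom_units]
    positivity

theorem integrable_exp_sq_div_four :
    Integrable (fun g : ℝ => Real.exp (g ^ 2 / 4)) (gaussianReal 0 1) := by
  rw [gaussianReal_of_var_ne_zero _ one_ne_zero]
  rw [integrable_withDensity_iff_integrable_smul' (measurable_gaussianPDF _ _)
    (ae_of_all _ fun _ => gaussianPDF_lt_top)]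
  refine ((integrable_exp_neg_mul_sq (b := 1 / 4) (by norm_num)).const_mul
    (√(2 * Real.pi))⁻¹).congr (ae_of_all _ fun x => ?_)
  simp only [toReal_gaussianPDF, gaussianPDFReal, smul_eq_mul, NNReal.coe_one, mul_one, mul_assoc,
    ← Real.exp_add]
  ring_nf

theorem sum_exp_sq_sum_sign_le {ι : Type*} [Fintype ι] [DecidableEq ι] (b : ℝ) (hb : 0 ≤ b)
    (hb' : b * Fintype.card ι ≤ 1 / 2) :
    ∑ ε : ι → ℤˣ, Real.exp (b / 2 * (∑ i, ((ε i : ℤ) : ℝ)) ^ 2) ≤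
      2 ^ Fintype.card ι * ∫ g, Real.exp (g ^ 2 / 4) ∂gaussianReal 0 1 := by
  have hsq : √b ^ 2 = b := Real.sq_sqrt hb
  have h1 : ∀ s : ℝ, Real.exp (b / 2 * s ^ 2) =
      ∫ g, Real.exp ((√b * s) * g) ∂gaussianReal 0 1 := by
    intro s
    have := congrFun (mgf_fun_id_gaussianReal (μ := 0) (v := 1)) (√b * s)
    simp only [mgf] at this
    rw [this, mul_pow, hsq]
    simp; ring_nf
  simp_rw [h1]
  rw [← integral_finsetSum _ fun ε _ => integrable_exp_mul_gaussianReal _, ← integral_const_mul]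
  refine integral_mono (integrable_finsetSum _ fun ε _ => integrable_exp_mul_gaussianReal _)
    (integrable_exp_sq_div_four.const_mul _) fun g => ?_
  have h2 : ∑ ε : ι → ℤˣ, Real.exp (√b * (∑ i, ((ε i : ℤ) : ℝ)) * g) =
      (2 * Real.cosh (√b * g)) ^ Fintype.card ι := by
    have : ∀ ε : ι → ℤˣ, Real.exp (√b * (∑ i, ((ε i : ℤ) : ℝ)) * g) =
        ∏ i, Real.exp (√b * g * ((ε i : ℤ) : ℝ)) := by
      intro ε
      rw [← Real.exp_sum, ← Finset.mul_sum]; ring_nf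
    simp_rw [this]
    rw [← Fintype.prod_sum (fun (_ : ι) (e : ℤˣ) => Real.exp (√b * g * ((e : ℤ) : ℝ)))]
    simp [Real.cosh_eq, UnitsInt.univ]
    ring_nf
  simp only
  rw [h2, mul_pow]
  gcongr
  calc _ ≤ Real.exp ((√b * g) ^ 2 / 2) ^ Fintype.card ι := by
        gcongr
        exact Real.cosh_le_exp_half_sq _
    _ ≤ _ := by
        rw [← Real.exp_nat_mul, mul_pow, hsq]
        gcongr
        nlinarith [sq_nonneg g]

open scoped Matrix in
theorem sum_eigenvalues_sub_one_sq {ι : Type*} [Fintype ι] [DecidableEq ι] {S : Matrix ι ι ℝ}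
    (hS : S.IsHermitian) :
    ∑ i, (hS.eigenvalues i - 1) ^ 2 = ∑ i, ∑ j, ((S - 1) i j) ^ 2 := by
  set φ := Unitary.conjStarAlgAut ℝ (Matrix ι ι ℝ) hS.eigenvectorUnitary with hφ
  have h1 : S = φ (Matrix.diagonal hS.eigenvalues) := by
    exact hS.spectral_theorem
  have h2 : (S - 1) * (S - 1) = φ (Matrix.diagonal fun i => (hS.eigenvalues i - 1) ^ 2) := by
    have h3 : Matrix.diagonal (fun i => (hS.eigenvalues i - 1) ^ 2) =
        (Matrix.diagonal hS.eigenvalues - 1) * (Matrix.diagonal hS.eigenvalues - 1) := by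
      rw [← Matrix.diagonal_one, Matrix.diagonal_sub, Matrix.diagonal_mul_diagonal]
      simp [sq]
    rw [h3, map_mul, map_sub, map_one, ← h1]
  have h4 : ((S - 1) * (S - 1)).trace = ∑ i, (hS.eigenvalues i - 1) ^ 2 := by
    rw [h2, hφ, Unitary.conjStarAlgAut_apply, Matrix.trace_mul_comm, ← mul_assoc]
    simp [Matrix.trace]
  rw [← h4, Matrix.trace]
  refine Finset.sum_congr rfl fun i _ => ?_
  rw [Matrix.diag_apply, Matrix.mul_apply]
  refine Finset.sum_congr rfl fun j _ => ?_
  have : (S - 1) j i = (S - 1) i j := by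
    have := (hS.sub Matrix.isHermitian_one).apply i j
    simpa using this
  rw [this, sq]

open scoped MatrixOrder in
theorem exists_mul_transpose_eq_of_sum_sq_le {ι : Type*} [Fintype ι] [DecidableEq ι]
    {S : Matrix ι ι ℝ} (hS : S.IsHermitian) (hd : ∀ i, S i i = 1)
    (h : ∑ i, ∑ j, ((S - 1) i j) ^ 2 ≤ 1 / 4) :
    ∃ M : Matrix ι ι ℝ, M * M.transpose = S ∧ M.det ≠ 0 ∧ |M.det⁻¹| ≤ Real.exp 1 := by
  rw [← sum_eigenvalues_sub_one_sq hS] at h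
  have hlam : ∀ i, 1 / 2 ≤ hS.eigenvalues i := by
    intro i
    have := (Finset.single_le_sum (f := fun i => (hS.eigenvalues i - 1) ^ 2)
      (fun i _ => sq_nonneg _) (Finset.mem_univ i)).trans h
    nlinarith
  have hpsd : S.PosSemidef := hS.posSemidef_iff_eigenvalues_nonneg.2 fun i => by
    have := hlam i
    simp only [Pi.zero_apply]; linarith
  obtain ⟨B, hB⟩ := CStarAlgebra.nonneg_iff_eq_star_mul_self.1
    (Matrix.nonneg_iff_posSemidef.2 hpsd)
  have hM : B.transpose * B.transpose.transpose = S := by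
    rw [hB, Matrix.star_eq_conjTranspose, Matrix.conjTranspose_eq_transpose_of_trivial,
      Matrix.transpose_transpose]
  have hdet : B.transpose.det ^ 2 = S.det := by
    rw [← hM, Matrix.det_mul, Matrix.det_transpose B.transpose, sq]
  have htr : ∑ i, (hS.eigenvalues i - 1) = 0 := by
    have := hS.trace_eq_sum_eigenvalues
    simp only [Matrix.trace, Matrix.diag_apply, hd] at this
    simp only [Finset.sum_sub_distrib, this]
    simp
  have hlow : Real.exp (-2) ≤ S.det := by
    have : ∀ i, (hS.eigenvalues i - 1) - 2 * (hS.eigenvalues i - 1) ^ 2 ≤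
        Real.log (hS.eigenvalues i) := by
      intro i
      have h0 : 0 < hS.eigenvalues i := by linarith [hlam i]
      refine le_trans ?_ (Real.one_sub_inv_le_log_of_pos h0)
      rw [← sub_nonneg]
      have : 1 - (hS.eigenvalues i)⁻¹ -
          ((hS.eigenvalues i - 1) - 2 * (hS.eigenvalues i - 1) ^ 2) =
          (hS.eigenvalues i - 1) ^ 2 * (2 * hS.eigenvalues i - 1) / hS.eigenvalues i := by
        field_simp; ring
      rw [this]
      have := hlam i
      exact div_nonneg (mul_nonneg (sq_nonneg _) (by linarith)) h0.le
    rw [hS.det_eq_prod_eigenvalues]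
    calc Real.exp (-2) ≤ Real.exp (∑ i, Real.log (hS.eigenvalues i)) := by
          rw [Real.exp_le_exp]
          refine le_trans ?_ (Finset.sum_le_sum fun i _ => this i)
          rw [Finset.sum_sub_distrib, htr, ← Finset.mul_sum]
          linarith
      _ = _ := by
          rw [Real.exp_sum]
          exact Finset.prod_congr rfl fun i _ => Real.exp_log (by linarith [hlam i])
  have hne : B.transpose.det ≠ 0 := by
    intro h0
    rw [h0] at hdet
    have := Real.exp_pos (-2)
    simp at hdet
    linarith
  refine ⟨B.transpose, hM, hne, ?_⟩
  refine abs_le_of_sq_le_sq ?_ (Real.exp_pos 1).le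
  rw [inv_pow, hdet, ← Real.exp_nat_mul]
  rw [inv_le_comm₀ ((Real.exp_pos _).trans_le hlow) (Real.exp_pos _), ← Real.exp_neg]
  norm_num
  exact hlow

theorem eq_map_pi_of_map_eq_gaussianReal {m : ℕ} {μ : Measure (Fin m → ℝ)} {S M : Matrix (Fin m) (Fin m) ℝ}
    [IsProbabilityMeasure μ]
    (h : ∀ t : Fin m → ℝ, μ.map (fun x => ∑ i, t i * x i) =
        gaussianReal 0 (Real.toNNReal (∑ i, ∑ j, t i * S i j * t j)))
    (hM : M * M.transpose = S) :
    μ = (Measure.pi fun _ => gaussianReal 0 1).map (Matrix.toLin' M) := by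
  have hmeas : Measurable (Matrix.toLin' M) := (LinearMap.continuous_of_finiteDimensional _).measurable
  have : IsProbabilityMeasure ((Measure.pi fun _ => gaussianReal 0 1).map (Matrix.toLin' M)) :=
    Measure.isProbabilityMeasure_map hmeas.aemeasurable
  refine Measure.ext_of_charFunDual (funext fun L => ?_)
  set t : Fin m → ℝ := fun i => L (Pi.single i 1) with ht
  have hL : ⇑L = fun x => ∑ i, t i * x i := by
    funext x
    have : x = ∑ i, x i • (Pi.single i (1 : ℝ) : Fin m → ℝ) := by
      ext j; simp [Finset.sum_apply, Pi.single_apply]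
    conv_lhs => rw [this]
    simp [map_sum, ht, mul_comm]
  have hq : ∑ i, ∑ j, t i * S i j * t j = ∑ k, (∑ i, t i * M i k) ^ 2 := by
    simp_rw [← hM, Matrix.mul_apply, Matrix.transpose_apply, sq, Finset.sum_mul_sum,
      Finset.mul_sum, Finset.sum_mul]
    rw [Finset.sum_comm (s := Finset.univ (α := Fin m)) (t := Finset.univ (α := Fin m))
      (f := fun k i => ∑ j, t i * M i k * (t j * M j k))]
    refine Finset.sum_congr rfl fun i _ => ?_
    rw [Finset.sum_comm]
    exact Finset.sum_congr rfl fun j _ => Finset.sum_congr rfl fun k _ => by ring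
  have hDk : ∀ k, (L.comp (Matrix.toLin' M).toContinuousLinearMap).comp
      (.single ℝ (fun _ => ℝ) k) 1 = ∑ i, t i * M i k := by
    intro k
    simp [hL, Matrix.mulVec_single]
  have hγ : ∀ D : StrongDual ℝ ℝ,
      charFunDual (gaussianReal 0 1) D = Complex.exp (-((D 1 ^ 2 : ℝ) : ℂ) / 2) := by
    intro D
    have : ∀ v, D v = D 1 * v := fun v => by
      conv_lhs => rw [← mul_one v, ← smul_eq_mul, map_smul, smul_eq_mul, mul_comm]
    have h1 := charFun_gaussianReal (μ := 0) (v := 1) (D 1)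
    rw [charFun_apply_real] at h1
    rw [charFunDual_apply]
    have h2 : ∀ v, Complex.exp (D v * Complex.I) = Complex.exp (D 1 * v * Complex.I) := fun v => by
      rw [this v, Complex.ofReal_mul]
    rw [integral_congr_ae (ae_of_all _ h2), h1]
    congr 1
    push_cast
    ring
  have hR : charFunDual ((Measure.pi fun _ => gaussianReal 0 1).map (Matrix.toLin' M)) L =
      Complex.exp (-((∑ k, (∑ i, t i * M i k) ^ 2 : ℝ) : ℂ) / 2) := by
    have h1 := charFunDual_map (μ := Measure.pi fun _ : Fin m => gaussianReal 0 1)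
      (Matrix.toLin' M).toContinuousLinearMap L
    rw [LinearMap.coe_toContinuousLinearMap'] at h1
    rw [h1, charFunDual_pi]
    simp_rw [hγ, hDk]
    rw [← Complex.exp_sum]
    push_cast
    rw [← Finset.sum_div, Finset.sum_neg_distrib]
  rw [hR, charFunDual_eq_charFun_map_one, hL, h t, charFun_gaussianReal, hq]
  congr 1
  have h0 : 0 ≤ ∑ k, (∑ i, t i * M i k) ^ 2 := Finset.sum_nonneg fun _ _ => sq_nonneg _
  have : ((Real.toNNReal (∑ k, (∑ i, t i * M i k) ^ 2) : ℝ) : ℂ) =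
      ((∑ k, (∑ i, t i * M i k) ^ 2 : ℝ) : ℂ) := by rw [Real.coe_toNNReal _ h0]
  rw [this]
  simp [neg_div]

theorem pi_gaussianReal_eq_withDensity (ι : Type*) [Fintype ι] :
    Measure.pi (fun _ : ι => gaussianReal 0 1) = (volume : Measure (ι → ℝ)).withDensity
      fun x => ENNReal.ofReal
        ((√(2 * Real.pi))⁻¹ ^ Fintype.card ι * Real.exp (-(∑ i, x i ^ 2) / 2)) := by
  have h := withDensity_pi (ι := ι) (f := fun _ => gaussianPDFReal 0 1)
    (fun _ x => gaussianPDFReal_nonneg 0 1 x) fun _ => integrable_gaussianPDFReal 0 1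
  rw [gaussianReal_of_var_ne_zero _ one_ne_zero]
  refine h.trans ?_
  congr 1
  funext x
  simp only [gaussianPDFReal, Finset.prod_mul_distrib, ← Real.exp_sum, Finset.prod_const,
    Finset.card_univ, sub_zero, NNReal.coe_one, mul_one, ← Finset.sum_div, Finset.sum_neg_distrib]

theorem sum_sq_mulVec_le {ι : Type*} [Fintype ι] [DecidableEq ι] {S M : Matrix ι ι ℝ}
    (hM : M * M.transpose = S) (z : ι → ℝ) :
    ∑ i, M.mulVec z i ^ 2 - ∑ i, ∑ j, (S - 1) i j * (M.mulVec z i * M.mulVec z j) ≤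
      ∑ i, z i ^ 2 := by
  set x := M.mulVec z with hx
  set y := M.transpose.mulVec x with hy
  have h1 : ∑ i, ∑ j, (S - 1) i j * (x i * x j) = y ⬝ᵥ y - x ⬝ᵥ x := by
    have : ∑ i, ∑ j, (S - 1) i j * (x i * x j) = x ⬝ᵥ ((S - 1).mulVec x) := by
      simp only [dotProduct, Matrix.mulVec, Finset.mul_sum]
      exact Finset.sum_congr rfl fun i _ => Finset.sum_congr rfl fun j _ => by ring
    rw [this, Matrix.sub_mulVec, Matrix.one_mulVec, dotProduct_sub, ← hM, ← Matrix.mulVec_mulVec,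
      Matrix.dotProduct_mulVec, ← Matrix.mulVec_transpose]
  have h2 : x ⬝ᵥ x = z ⬝ᵥ y := by
    rw [hy, Matrix.mulVec_transpose, dotProduct_comm z, ← Matrix.dotProduct_mulVec]
  have h3 : ∀ v : ι → ℝ, ∑ i, v i ^ 2 = v ⬝ᵥ v := fun v => by simp [dotProduct, sq]
  have h4 : 0 ≤ (z - y) ⬝ᵥ (z - y) := by
    rw [← h3]; exact Finset.sum_nonneg fun _ _ => sq_nonneg _
  rw [h1, h3, h3]
  simp only [sub_dotProduct, dotProduct_sub] at h4
  rw [dotProduct_comm y z] at h4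
  linarith

theorem map_mulVec_pi_gaussianReal_le {ι : Type*} [Fintype ι] [DecidableEq ι] {S M : Matrix ι ι ℝ}
    (hM : M * M.transpose = S) (hdet : M.det ≠ 0) {A : Set (ι → ℝ)} (hA : MeasurableSet A) :
    (Measure.pi fun _ : ι => gaussianReal 0 1).map (Matrix.toLin' M) A ≤
      ENNReal.ofReal |M.det⁻¹| * ∫⁻ x in A,
        ENNReal.ofReal (Real.exp (∑ i, ∑ j, 1 / 2 * (S - 1) i j * (x i * x j)))
          ∂Measure.pi fun _ : ι => gaussianReal 0 1 := by
  have hmeas : Measurable (Matrix.toLin' M) :=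
    (LinearMap.continuous_of_finiteDimensional _).measurable
  rw [pi_gaussianReal_eq_withDensity, Measure.map_apply hmeas hA,
    withDensity_apply _ (hmeas hA), restrict_withDensity hA,
    lintegral_withDensity_eq_lintegral_mul _ (by fun_prop) (by fun_prop),
    ← smul_eq_mul (ENNReal.ofReal |M.det⁻¹|), ← lintegral_smul_measure, ← Measure.restrict_smul,
    ← Real.map_matrix_volume_pi_eq_smul_volume_pi hdet, setLIntegral_map hA (by fun_prop) hmeas]
  refine lintegral_mono fun z => ?_
  simp only [Pi.mul_apply, Matrix.toLin'_apply]
  rw [← ENNReal.ofReal_mul (by positivity), mul_assoc, ← Real.exp_add]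
  have h := sum_sq_mulVec_le hM z
  have h2 : ∑ i, ∑ j, 1 / 2 * (S - 1) i j * (M.mulVec z i * M.mulVec z j) =
      1 / 2 * ∑ i, ∑ j, (S - 1) i j * (M.mulVec z i * M.mulVec z j) := by
    simp only [Finset.mul_sum, mul_assoc]
  rw [h2]
  gcongr
  linarith

theorem measurePreserving_sign_pi_gaussianReal {ι : Type*} [Fintype ι] (ε : ι → ℤˣ) :
    MeasurePreserving (fun (x : ι → ℝ) i => ((ε i : ℤ) : ℝ) * x i)
      (Measure.pi fun _ => gaussianReal 0 1) (Measure.pi fun _ => gaussianReal 0 1) := by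
  refine measurePreserving_pi (f := fun i x => ((ε i : ℤ) : ℝ) * x) _ _ fun i =>
    ⟨by fun_prop, ?_⟩
  rw [gaussianReal_map_const_mul]
  rcases Int.units_eq_one_or (ε i) with h | h <;> simp [h]

theorem measurableSet_forall_abs_le {ι : Type*} [Countable ι] (κ : ℝ) :
    MeasurableSet {x : ι → ℝ | ∀ i, |x i| ≤ κ} := by
  rw [Set.ofPred_forall]
  exact MeasurableSet.iInter fun i => measurableSet_le (by fun_prop) measurable_const

theorem setLIntegral_exp_quadratic_le {ι : Type*} [Fintype ι] [DecidableEq ι] {w : ι → ι → ℝ}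
    {κ b : ℝ} (hb : 0 ≤ b) (hb' : b * Fintype.card ι ≤ 1 / 2)
    (hw : ∀ i j, |w i j| * κ ^ 2 ≤ b / 2) :
    ∫⁻ x in {x : ι → ℝ | ∀ i, |x i| ≤ κ},
        ENNReal.ofReal (Real.exp (∑ i, ∑ j, w i j * (x i * x j)))
          ∂Measure.pi (fun _ : ι => gaussianReal 0 1) ≤
      ENNReal.ofReal (∫ g, Real.exp (g ^ 2 / 4) ∂gaussianReal 0 1) *
        (Measure.pi fun _ : ι => gaussianReal 0 1) {x | ∀ i, |x i| ≤ κ} := by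
  set γ := Measure.pi fun _ : ι => gaussianReal 0 1
  set A := {x : ι → ℝ | ∀ i, |x i| ≤ κ} with hA
  have hAm : MeasurableSet A := measurableSet_forall_abs_le κ
  set K := ∫ g, Real.exp (g ^ 2 / 4) ∂gaussianReal 0 1
  set G : (ι → ℝ) → ENNReal := fun x =>
    ENNReal.ofReal (Real.exp (∑ i, ∑ j, w i j * (x i * x j))) with hG
  have hGm : Measurable G := by fun_prop
  have hflip : ∀ ε : ι → ℤˣ,
      ∫⁻ x in A, G (fun i => ((ε i : ℤ) : ℝ) * x i) ∂γ = ∫⁻ x in A, G x ∂γ := by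
    intro ε
    have hpre : (fun (x : ι → ℝ) i => ((ε i : ℤ) : ℝ) * x i) ⁻¹' A = A := by
      ext x
      simp only [hA, Set.mem_preimage, Set.mem_ofPred_eq, abs_mul]
      refine forall_congr' fun i => ?_
      rcases Int.units_eq_one_or (ε i) with h | h <;> simp [h]
    rw [← (measurePreserving_sign_pi_gaussianReal ε).setLIntegral_comp_preimage hAm hGm, hpre]
  have hpt : ∀ x ∈ A, ∑ ε : ι → ℤˣ, G (fun i => ((ε i : ℤ) : ℝ) * x i) ≤
      ENNReal.ofReal (2 ^ Fintype.card ι * K) := by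
    intro x hx
    simp only [hG]
    rw [← ENNReal.ofReal_sum_of_nonneg fun _ _ => (Real.exp_pos _).le]
    refine ENNReal.ofReal_le_ofReal (le_trans ?_ (sum_exp_sq_sum_sign_le b hb hb'))
    have hle := sum_exp_sign_le (fun p : ι × ι => w p.1 p.2 * (x p.1 * x p.2)) (fun _ => b / 2) ?_
    · refine (Eq.le ?_).trans (hle.trans (Eq.le ?_))
      · refine Finset.sum_congr rfl fun ε _ => ?_
        rw [Fintype.sum_prod_type]
        exact congrArg _ (Finset.sum_congr rfl fun i _ => Finset.sum_congr rfl fun j _ => by ring)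
      · refine Finset.sum_congr rfl fun ε _ => ?_
        rw [← Finset.mul_sum, Fintype.sum_prod_type, sq, Finset.sum_mul_sum]
    · rintro ⟨i, j⟩
      refine le_trans ?_ (hw i j)
      rw [abs_mul, abs_mul, sq]
      have h1 := hx i
      have h2 := hx j
      gcongr
      exact (abs_nonneg _).trans h1
  have hsum : (2 : ENNReal) ^ Fintype.card ι * ∫⁻ x in A, G x ∂γ ≤
      2 ^ Fintype.card ι * (ENNReal.ofReal K * γ A) := by
    calc (2 : ENNReal) ^ Fintype.card ι * ∫⁻ x in A, G x ∂γ
        = ∑ ε : ι → ℤˣ, ∫⁻ x in A, G (fun i => ((ε i : ℤ) : ℝ) * x i) ∂γ := by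
          simp [hflip]
      _ = ∫⁻ x in A, ∑ ε : ι → ℤˣ, G (fun i => ((ε i : ℤ) : ℝ) * x i) ∂γ :=
          (lintegral_finsetSum _ fun ε _ => by fun_prop).symm
      _ ≤ ∫⁻ _ in A, ENNReal.ofReal (2 ^ Fintype.card ι * K) ∂γ :=
          setLIntegral_mono' hAm hpt
      _ = _ := by
          rw [setLIntegral_const, ENNReal.ofReal_mul (by positivity), mul_assoc,
            ENNReal.ofReal_pow (by norm_num), ENNReal.ofReal_ofNat]
  exact (ENNReal.mul_le_mul_iff_right (by positivity) (by finiteness)).1 hsum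

theorem IsCenteredGaussianVec.symmetrize {m : ℕ} {μ : Measure (Fin m → ℝ)} {Cov : Matrix (Fin m) (Fin m) ℝ}
    (h : IsCenteredGaussianVec μ Cov) :
    IsCenteredGaussianVec μ ((1 / 2 : ℝ) • (Cov + Cov.transpose)) := by
  refine ⟨h.1, fun t => ?_⟩
  rw [h.2 t]
  congr 2
  have h1 : ∑ i, ∑ j, t i * Cov j i * t j = ∑ i, ∑ j, t i * Cov i j * t j := by
    rw [Finset.sum_comm]
    exact Finset.sum_congr rfl fun i _ => Finset.sum_congr rfl fun j _ => by ring
  have h2 : ∀ i j, t i * ((1 / 2 : ℝ) • (Cov + Cov.transpose)) i j * t j =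
      1 / 2 * (t i * Cov i j * t j) + 1 / 2 * (t i * Cov j i * t j) := fun i j => by
    simp only [Matrix.smul_apply, Matrix.add_apply, Matrix.transpose_apply, smul_eq_mul]; ring
  simp only [h2, Finset.sum_add_distrib, ← Finset.mul_sum, h1]
  ring

theorem stmt9 (κ : ℝ) (hκ : 0 < κ) :
    ∃ cκ > (0:ℝ), ∃ C > (0:ℝ), ∀ m : ℕ, 0 < m →
      ∀ (μ : Measure (Fin m → ℝ)) (Cov : Matrix (Fin m) (Fin m) ℝ),
        IsCenteredGaussianVec μ Cov → (∀ i, Cov i i = 1) →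
        (∀ i j, i ≠ j → |Cov i j| ≤ cκ / m) →
        (μ {x | ∀ i, |x i| ≤ κ}).toReal ≤
          C * ((gaussianReal 0 1 {z | |z| ≤ κ}).toReal) ^ m := by
  have hden : 0 < 2 * (1 + κ ^ 2) := by positivity
  set c := 1 / (2 * (1 + κ ^ 2)) with hc
  have hc0 : 0 < c := by positivity
  have hc2 : c ≤ 1 / 2 := by
    rw [hc]; exact one_div_le_one_div_of_le (by norm_num) (by nlinarith [sq_nonneg κ])
  have hcκ : c * κ ^ 2 ≤ 1 / 2 := by
    rw [hc, div_mul_eq_mul_div, div_le_iff₀ hden]; nlinarith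
  set K := ∫ g, Real.exp (g ^ 2 / 4) ∂gaussianReal 0 1
  have hK : 0 < K := integral_exp_pos integrable_exp_sq_div_four
  refine ⟨c, hc0, Real.exp 1 * K, by positivity, fun m hm μ Cov hμ hdiag hoff => ?_⟩
  have hm' : (0 : ℝ) < m := by exact_mod_cast hm
  set S := (1 / 2 : ℝ) • (Cov + Cov.transpose) with hSdef
  have hSμ : IsCenteredGaussianVec μ S := hμ.symmetrize
  have hS : S.IsHermitian := by
    ext i j
    simp [hSdef, add_comm]
  have hSd : ∀ i, S i i = 1 := fun i => by
    simp [hSdef, hdiag]; norm_num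
  have hSE : ∀ i j, |(S - 1) i j| ≤ c / m := by
    intro i j
    rcases eq_or_ne i j with rfl | hij
    · simp only [Matrix.sub_apply, hSd, Matrix.one_apply_eq, sub_self, abs_zero]; positivity
    · have h1 := abs_le.1 (hoff i j hij)
      have h2 := abs_le.1 (hoff j i hij.symm)
      simp only [hSdef, Matrix.sub_apply, Matrix.smul_apply, Matrix.add_apply,
        Matrix.transpose_apply, Matrix.one_apply_ne hij, smul_eq_mul, sub_zero]
      rw [abs_le]
      constructor <;> linarith [h1.1, h1.2, h2.1, h2.2]
  have hsq : ∑ i, ∑ j, ((S - 1) i j) ^ 2 ≤ 1 / 4 := by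
    calc ∑ i, ∑ j, ((S - 1) i j) ^ 2 ≤ ∑ _i : Fin m, ∑ _j : Fin m, (c / m) ^ 2 :=
          Finset.sum_le_sum fun i _ => Finset.sum_le_sum fun j _ =>
            sq_le_sq.2 ((hSE i j).trans (le_abs_self _))
      _ = c ^ 2 := by simp; field_simp
      _ ≤ 1 / 4 := by nlinarith
  obtain ⟨M, hM, hdet, hdet'⟩ := exists_mul_transpose_eq_of_sum_sq_le hS hSd hsq
  have := hSμ.1
  have hAm : MeasurableSet {x : Fin m → ℝ | ∀ i, |x i| ≤ κ} :=
    measurableSet_forall_abs_le κ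
  have hγ : (Measure.pi fun _ : Fin m => gaussianReal 0 1) {x | ∀ i, |x i| ≤ κ} =
      gaussianReal 0 1 {z | |z| ≤ κ} ^ m := by
    have : {x : Fin m → ℝ | ∀ i, |x i| ≤ κ} = Set.univ.pi fun _ => {z | |z| ≤ κ} := by
      ext x; simp
    rw [this, Measure.pi_pi]
    simp
  have hb : c * κ ^ 2 / m * Fintype.card (Fin m) ≤ 1 / 2 := by
    rw [Fintype.card_fin, div_mul_cancel₀ _ hm'.ne']; exact hcκ
  have hbound : μ {x | ∀ i, |x i| ≤ κ} ≤
      ENNReal.ofReal (Real.exp 1) * (ENNReal.ofReal K * gaussianReal 0 1 {z | |z| ≤ κ} ^ m) := by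
    rw [eq_map_pi_of_map_eq_gaussianReal hSμ.2 hM, ← hγ]
    refine (map_mulVec_pi_gaussianReal_le hM hdet hAm).trans ?_
    refine mul_le_mul' (ENNReal.ofReal_le_ofReal hdet')
      (setLIntegral_exp_quadratic_le (by positivity) hb fun i j => ?_)
    rw [abs_mul, abs_of_pos (by norm_num : (0 : ℝ) < 1 / 2)]
    calc 1 / 2 * |(S - 1) i j| * κ ^ 2 ≤ 1 / 2 * (c / m) * κ ^ 2 := by gcongr; exact hSE i j
      _ = _ := by ring
  refine (ENNReal.toReal_mono (by finiteness) hbound).trans (Eq.le ?_)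
  rw [ENNReal.toReal_mul, ENNReal.toReal_mul, ENNReal.toReal_pow,
    ENNReal.toReal_ofReal (Real.exp_pos 1).le, ENNReal.toReal_ofReal hK.le, mul_assoc]

end
end

section
/- For every κ > 0 there exist constants c_κ > 0 and C > 0 such that for all m ∈ ℕ: if (X₁,...,X_m) is a centered Gaussian vector with E[X_i²] = 1 and |E[X_i X_j]| ≤ c_κ/m for i ≠ j, then P(min_{1≤i≤m} |X_i| > κ) ≤ C · P(|Z| > κ)^m, where Z is a standard Gaussian. -/
open MeasureTheory ProbabilityTheory

noncomputable section

open scoped Matrix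

lemma lintegral_ofReal_exp_neg_mul_sq {b : ℝ} (hb : 0 < b) :
    ∫⁻ z : ℝ, ENNReal.ofReal (Real.exp (-b * z ^ 2)) = ENNReal.ofReal √(Real.pi / b) := by
  rw [← integral_gaussian, ofReal_integral_eq_lintegral_ofReal (integrable_exp_neg_mul_sq hb)]
  exact Filter.Eventually.of_forall fun z => (Real.exp_pos _).le

/-- Averaging over `z ↦ -z` replaces `exp (l * z)` by `cosh (l * z)`. -/
lemma setLIntegral_exp_mul_eq_cosh (κ a l : ℝ) :
    ∫⁻ z in {z : ℝ | κ < |z|}, ENNReal.ofReal (Real.exp (a * z ^ 2 + l * z)) =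
      ∫⁻ z in {z : ℝ | κ < |z|}, ENNReal.ofReal (Real.exp (a * z ^ 2) * Real.cosh (l * z)) := by
  have hS : MeasurableSet {z : ℝ | κ < |z|} := measurableSet_lt (by fun_prop) (by fun_prop)
  have hneg : ∫⁻ z in {z : ℝ | κ < |z|}, ENNReal.ofReal (Real.exp (a * z ^ 2 + l * z)) =
      ∫⁻ z in {z : ℝ | κ < |z|}, ENNReal.ofReal (Real.exp (a * z ^ 2 - l * z)) := by
    rw [← lintegral_indicator hS, ← lintegral_indicator hS, ← lintegral_neg_eq_self]
    refine lintegral_congr fun z => ?_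
    simp only [Set.indicator, Set.mem_ofPred_eq, abs_neg, neg_sq, mul_neg, ← sub_eq_add_neg]
  have hadd : (∫⁻ z in {z : ℝ | κ < |z|}, ENNReal.ofReal (Real.exp (a * z ^ 2 + l * z))) +
      ∫⁻ z in {z : ℝ | κ < |z|}, ENNReal.ofReal (Real.exp (a * z ^ 2 - l * z)) =
      2 * ∫⁻ z in {z : ℝ | κ < |z|},
        ENNReal.ofReal (Real.exp (a * z ^ 2) * Real.cosh (l * z)) := by
    rw [← lintegral_add_left (by fun_prop), ← lintegral_const_mul _ (by fun_prop)]
    refine lintegral_congr fun z => ?_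
    rw [← ENNReal.ofReal_add (Real.exp_pos _).le (Real.exp_pos _).le,
      show (2 : ENNReal) = ENNReal.ofReal 2 by simp, ← ENNReal.ofReal_mul (by norm_num),
      Real.cosh_eq, Real.exp_add, sub_eq_add_neg, Real.exp_add]
    congr 1
    ring
  rw [← hneg, ← two_mul] at hadd
  exact (ENNReal.mul_right_inj (by norm_num) (by norm_num)).1 hadd

lemma exp_mul_cosh_le {s l z : ℝ} (hs : 0 ≤ s) (hs' : s ≤ 1 / 4) :
    Real.exp (s * z ^ 2 / 2) * Real.cosh (l * z) ≤
      1 + 4 * (s + l ^ 2) * Real.exp (2 * l ^ 2) * Real.exp (3 * z ^ 2 / 8) := by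
  set F := Real.exp (s * z ^ 2 / 2) * Real.cosh (l * z) with hF
  have hF0 : 0 < F := mul_pos (Real.exp_pos _) (Real.cosh_pos _)
  have h1 : F ≤ Real.exp ((s + l ^ 2) * z ^ 2 / 2) := by
    calc F ≤ Real.exp (s * z ^ 2 / 2) * Real.exp ((l * z) ^ 2 / 2) := by
          exact mul_le_mul_of_nonneg_left (Real.cosh_le_exp_half_sq _) (Real.exp_pos _).le
      _ = _ := by rw [← Real.exp_add]; ring_nf
  have h2 : F ≤ 1 + (s + l ^ 2) * z ^ 2 / 2 * F := by
    have h3 := Real.add_one_le_exp (-((s + l ^ 2) * z ^ 2 / 2))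
    have h4 : F * Real.exp (-((s + l ^ 2) * z ^ 2 / 2)) ≤ 1 := by
      rw [Real.exp_neg, ← div_eq_mul_inv, div_le_one (Real.exp_pos _)]; exact h1
    nlinarith
  have h5 : F ≤ Real.exp (2 * l ^ 2) * Real.exp (z ^ 2 / 4) := by
    have hc : Real.cosh (l * z) ≤ Real.exp (z ^ 2 / 8 + 2 * l ^ 2) := by
      rw [Real.cosh_eq]
      have ha : Real.exp (l * z) ≤ Real.exp (z ^ 2 / 8 + 2 * l ^ 2) := by
        gcongr; nlinarith [sq_nonneg (z - 4 * l)]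
      have hb : Real.exp (-(l * z)) ≤ Real.exp (z ^ 2 / 8 + 2 * l ^ 2) := by
        gcongr; nlinarith [sq_nonneg (z + 4 * l)]
      linarith
    calc F ≤ Real.exp (z ^ 2 / 8) * Real.exp (z ^ 2 / 8 + 2 * l ^ 2) := by
          refine mul_le_mul (Real.exp_le_exp.2 ?_) hc (Real.cosh_pos _).le (Real.exp_pos _).le
          nlinarith [sq_nonneg z]
      _ = _ := by rw [← Real.exp_add, ← Real.exp_add]; ring_nf
  have h6 : z ^ 2 ≤ 8 * Real.exp (z ^ 2 / 8) := by
    linarith [Real.add_one_le_exp (z ^ 2 / 8)]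
  calc F ≤ 1 + (s + l ^ 2) * z ^ 2 / 2 * F := h2
    _ ≤ 1 + (s + l ^ 2) * (8 * Real.exp (z ^ 2 / 8)) / 2 *
        (Real.exp (2 * l ^ 2) * Real.exp (z ^ 2 / 4)) := by gcongr
    _ = 1 + 4 * (s + l ^ 2) * Real.exp (2 * l ^ 2) *
        (Real.exp (z ^ 2 / 8) * Real.exp (z ^ 2 / 4)) := by ring
    _ = _ := by rw [← Real.exp_add]; ring_nf

/-- Tilting a Gaussian conditioned on a symmetric set costs only a factor of second order in the
linear term. -/
lemma exists_setLIntegral_exp_le (κ Q : ℝ) (hQ : 0 < Q)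
    (hQe : ∫⁻ z in {z : ℝ | κ < |z|}, ENNReal.ofReal (Real.exp (-(1 / 2) * z ^ 2)) =
      ENNReal.ofReal Q) :
    ∃ K > 0, ∀ s l : ℝ, 0 ≤ s → s ≤ 1 / 4 →
      ∫⁻ z in {z : ℝ | κ < |z|}, ENNReal.ofReal (Real.exp ((s - 1) / 2 * z ^ 2 + l * z)) ≤
        ENNReal.ofReal (Q * Real.exp (K * (s + l ^ 2))) := by
  have hR : 0 < √(Real.pi / (1 / 8)) := by positivity
  set R := √(Real.pi / (1 / 8)) with hRdef
  refine ⟨4 * R / Q + 2, by positivity, fun s l hs hs' => ?_⟩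
  rw [setLIntegral_exp_mul_eq_cosh]
  have hD : 0 ≤ 4 * (s + l ^ 2) * Real.exp (2 * l ^ 2) := by positivity
  set D := 4 * (s + l ^ 2) * Real.exp (2 * l ^ 2) with hDdef
  calc ∫⁻ z in {z : ℝ | κ < |z|},
        ENNReal.ofReal (Real.exp ((s - 1) / 2 * z ^ 2) * Real.cosh (l * z))
      ≤ ∫⁻ z in {z : ℝ | κ < |z|}, (ENNReal.ofReal (Real.exp (-(1 / 2) * z ^ 2)) +
          ENNReal.ofReal D * ENNReal.ofReal (Real.exp (-(1 / 8) * z ^ 2))) := by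
        refine lintegral_mono fun z => ?_
        simp only
        rw [← ENNReal.ofReal_mul hD, ← ENNReal.ofReal_add (Real.exp_pos _).le (by positivity)]
        refine ENNReal.ofReal_le_ofReal ?_
        have h := mul_le_mul_of_nonneg_left (exp_mul_cosh_le (l := l) (z := z) hs hs')
          (Real.exp_pos (-(1 / 2) * z ^ 2)).le
        have e1 : Real.exp ((s - 1) / 2 * z ^ 2) =
            Real.exp (-(1 / 2) * z ^ 2) * Real.exp (s * z ^ 2 / 2) := by
          rw [← Real.exp_add]; ring_nf
        have e2 : Real.exp (-(1 / 8) * z ^ 2) =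
            Real.exp (-(1 / 2) * z ^ 2) * Real.exp (3 * z ^ 2 / 8) := by
          rw [← Real.exp_add]; ring_nf
        rw [e1, e2]
        calc _ = _ := mul_assoc _ _ _
          _ ≤ _ := h
          _ = _ := by rw [hDdef]; ring
    _ = ENNReal.ofReal Q + ENNReal.ofReal D *
          ∫⁻ z in {z : ℝ | κ < |z|}, ENNReal.ofReal (Real.exp (-(1 / 8) * z ^ 2)) := by
        rw [lintegral_add_left (by fun_prop), hQe, lintegral_const_mul _ (by fun_prop)]
    _ ≤ ENNReal.ofReal Q + ENNReal.ofReal D * ENNReal.ofReal R := by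
        gcongr
        rw [hRdef, ← lintegral_ofReal_exp_neg_mul_sq (by norm_num)]
        exact setLIntegral_le_lintegral _ _
    _ = ENNReal.ofReal (Q + D * R) := by
        rw [← ENNReal.ofReal_mul hD, ← ENNReal.ofReal_add hQ.le (by positivity)]
    _ ≤ _ := by
        refine ENNReal.ofReal_le_ofReal ?_
        set u := 4 * R / Q * (s + l ^ 2) with hu
        have hu0 : 0 ≤ u := by positivity
        have e : Q + D * R = Q * (1 + u * Real.exp (2 * l ^ 2)) := by
          rw [hDdef, hu]; field_simp
        rw [e]
        gcongr
        have h1 : 1 ≤ Real.exp (2 * l ^ 2) := Real.one_le_exp (by positivity)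
        calc 1 + u * Real.exp (2 * l ^ 2) ≤ (u + 1) * Real.exp (2 * l ^ 2) := by linarith
          _ ≤ Real.exp u * Real.exp (2 * l ^ 2) := by gcongr; exact Real.add_one_le_exp u
          _ = Real.exp (u + 2 * l ^ 2) := (Real.exp_add _ _).symm
          _ ≤ _ := by gcongr; rw [hu]; nlinarith

lemma le_lintegral_exp {b s : ℝ} (l : ℝ) (hb : 0 ≤ b) (hs : -b ≤ s) :
    ENNReal.ofReal (√(2 * Real.pi) * Real.exp (-b / 2)) ≤
      ∫⁻ z : ℝ, ENNReal.ofReal (Real.exp ((s - 1) / 2 * z ^ 2 + l * z)) := by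
  have huniv : {z : ℝ | (-1 : ℝ) < |z|} = Set.univ :=
    Set.eq_univ_of_forall fun z => lt_of_lt_of_le (by norm_num) (abs_nonneg z)
  have h := setLIntegral_exp_mul_eq_cosh (-1) ((s - 1) / 2) l
  rw [huniv, setLIntegral_univ, setLIntegral_univ] at h
  rw [h]
  calc ENNReal.ofReal (√(2 * Real.pi) * Real.exp (-b / 2))
      ≤ ENNReal.ofReal √(Real.pi / ((1 + b) / 2)) := by
        refine ENNReal.ofReal_le_ofReal (Real.le_sqrt_of_sq_le ?_)
        rw [mul_pow, Real.sq_sqrt (by positivity), ← Real.exp_nat_mul]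
        have h1 : Real.exp (-b) ≤ 1 / (1 + b) := by
          rw [Real.exp_neg, ← one_div]
          exact one_div_le_one_div_of_le (by linarith) (by linarith [Real.add_one_le_exp b])
        have h2 : ((2 : ℕ) : ℝ) * (-b / 2) = -b := by push_cast; ring
        rw [h2]
        calc 2 * Real.pi * Real.exp (-b) ≤ 2 * Real.pi * (1 / (1 + b)) := by gcongr
          _ = _ := by field_simp
    _ = ∫⁻ z : ℝ, ENNReal.ofReal (Real.exp (-((1 + b) / 2) * z ^ 2)) :=
        (lintegral_ofReal_exp_neg_mul_sq (by linarith)).symm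
    _ ≤ _ := by
        refine lintegral_mono fun z => ENNReal.ofReal_le_ofReal ?_
        calc Real.exp (-((1 + b) / 2) * z ^ 2) ≤ Real.exp ((s - 1) / 2 * z ^ 2) := by
              gcongr; linarith
          _ ≤ _ := le_mul_of_one_le_right (Real.exp_pos _).le (Real.one_le_cosh _)

lemma lintegral_fin_succ {n : ℕ} {f : (Fin (n + 1) → ℝ) → ENNReal} (hf : Measurable f) :
    ∫⁻ y, f y = ∫⁻ x : Fin n → ℝ, ∫⁻ z : ℝ, f (Fin.cons z x) := by
  have h := (volume_preserving_piFinSuccAbove (fun _ : Fin (n + 1) => ℝ) 0).symm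
  rw [← h.lintegral_comp_emb (MeasurableEquiv.measurableEmbedding _) f, Measure.volume_eq_prod]
  refine (lintegral_prod_symm _ (hf.comp (MeasurableEquiv.measurable _)).aemeasurable).trans ?_
  simp [MeasurableEquiv.piFinSuccAbove_symm_apply, Fin.insertNthEquiv]

/-- The Gaussian weight with quadratic perturbation `A`. -/
def gaussWeight {n : ℕ} (A : Matrix (Fin n) (Fin n) ℝ) (x : Fin n → ℝ) : ENNReal :=
  ENNReal.ofReal (Real.exp (-(∑ i, x i ^ 2) / 2 + (∑ i, ∑ j, A i j * x i * x j) / 2))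

lemma measurable_gaussWeight {n : ℕ} (A : Matrix (Fin n) (Fin n) ℝ) :
    Measurable (gaussWeight A) := by
  unfold gaussWeight
  fun_prop

lemma gaussWeight_cons {n : ℕ} (A : Matrix (Fin (n + 1)) (Fin (n + 1)) ℝ) (z : ℝ)
    (x : Fin n → ℝ) :
    gaussWeight A (Fin.cons z x) =
      ENNReal.ofReal (Real.exp ((A 0 0 - 1) / 2 * z ^ 2 +
        (∑ j : Fin n, (A 0 j.succ + A j.succ 0) / 2 * x j) * z)) *
      gaussWeight (A.submatrix Fin.succ Fin.succ) x := by
  unfold gaussWeight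
  rw [← ENNReal.ofReal_mul (Real.exp_pos _).le, ← Real.exp_add]
  congr 2
  simp only [Fin.sum_univ_succ, Fin.cons_zero, Fin.cons_succ, Matrix.submatrix_apply,
    Finset.sum_add_distrib, add_div, add_mul, Finset.sum_mul]
  have e1 : ∑ j : Fin n, A 0 j.succ / 2 * x j * z = (∑ j : Fin n, A 0 j.succ * z * x j) / 2 := by
    rw [Finset.sum_div]; exact Finset.sum_congr rfl fun j _ => by ring
  have e2 : ∑ j : Fin n, A j.succ 0 / 2 * x j * z = (∑ j : Fin n, A j.succ 0 * x j * z) / 2 := by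
    rw [Finset.sum_div]; exact Finset.sum_congr rfl fun j _ => by ring
  rw [e1, e2]
  ring

lemma exp_mul_gaussWeight {n : ℕ} (A : Matrix (Fin n) (Fin n) ℝ) (l x : Fin n → ℝ) (K : ℝ) :
    ENNReal.ofReal (Real.exp (K * (∑ j, l j * x j) ^ 2)) * gaussWeight A x =
      gaussWeight (Matrix.of fun i j => A i j + 2 * K * (l i * l j)) x := by
  unfold gaussWeight
  rw [← ENNReal.ofReal_mul (Real.exp_pos _).le, ← Real.exp_add]
  congr 2
  have e : (∑ j, l j * x j) ^ 2 = ∑ i, ∑ j, l i * l j * x i * x j := by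
    rw [sq, Finset.sum_mul_sum]
    exact Finset.sum_congr rfl fun i _ => Finset.sum_congr rfl fun j _ => by ring
  simp only [Matrix.of_apply, add_mul, Finset.sum_add_distrib, mul_assoc, ← Finset.mul_sum] at *
  rw [e]
  ring

lemma le_lintegral_gaussWeight {b : ℝ} (hb : 0 ≤ b) : ∀ {n : ℕ} (A : Matrix (Fin n) (Fin n) ℝ),
    (∀ i, -b ≤ A i i) →
    ENNReal.ofReal ((√(2 * Real.pi) * Real.exp (-b / 2)) ^ n) ≤ ∫⁻ x, gaussWeight A x
  | 0, A, _ => by simp [gaussWeight, volume_pi]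
  | n + 1, A, hA => by
    rw [lintegral_fin_succ (measurable_gaussWeight A), pow_succ', ENNReal.ofReal_mul (by positivity)]
    have ih := le_lintegral_gaussWeight hb (A.submatrix Fin.succ Fin.succ) fun i => hA i.succ
    calc _ ≤ _ := mul_le_mul_right ih _
      _ = ∫⁻ x, ENNReal.ofReal (√(2 * Real.pi) * Real.exp (-b / 2)) *
            gaussWeight (A.submatrix Fin.succ Fin.succ) x :=
          (lintegral_const_mul _ (measurable_gaussWeight _)).symm
      _ ≤ _ := by
          refine lintegral_mono fun x => ?_
          simp only [gaussWeight_cons]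
          rw [lintegral_mul_const _ (by fun_prop)]
          gcongr
          exact le_lintegral_exp _ hb (hA 0)

lemma setLIntegral_gaussWeight_le {κ Q K B : ℝ} (hQ : 0 < Q) (hK : 0 < K) (hB : 0 ≤ B)
    (hB' : B ≤ 1 / 4)
    (h : ∀ s l : ℝ, 0 ≤ s → s ≤ 1 / 4 →
      ∫⁻ z in {z : ℝ | κ < |z|}, ENNReal.ofReal (Real.exp ((s - 1) / 2 * z ^ 2 + l * z)) ≤
        ENNReal.ofReal (Q * Real.exp (K * (s + l ^ 2)))) :
    ∀ {n : ℕ} (A : Matrix (Fin n) (Fin n) ℝ), (∀ i j, |A i j| ≤ B - n * (2 * K * B ^ 2)) →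
    ∫⁻ x in {x | ∀ i, κ < |x i|}, gaussWeight A x ≤
      ENNReal.ofReal ((Q * Real.exp (K * B)) ^ n)
  | 0, A, _ => by simp [gaussWeight, volume_pi]
  | n + 1, A, hA => by
    have hS : ∀ k : ℕ, MeasurableSet {x : Fin k → ℝ | ∀ i, κ < |x i|} := fun k => by
      simp only [Set.ofPred_forall]
      exact MeasurableSet.iInter fun i => measurableSet_lt (by fun_prop) (by fun_prop)
    have hS1 : MeasurableSet {z : ℝ | κ < |z|} := measurableSet_lt (by fun_prop) (by fun_prop)
    have hAB : ∀ i j, |A i j| ≤ B := fun i j => (hA i j).trans (by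
      have : 0 ≤ ((n + 1 : ℕ) : ℝ) * (2 * K * B ^ 2) := by positivity
      linarith)
    set l : Fin n → ℝ := fun j => (A 0 j.succ + A j.succ 0) / 2 with hl
    have hlB : ∀ j, |l j| ≤ B := fun j => by
      rw [hl, abs_le]
      have h1 := abs_le.1 (hAB 0 j.succ)
      have h2 := abs_le.1 (hAB j.succ 0)
      constructor <;> simp only <;> linarith
    set A' : Matrix (Fin n) (Fin n) ℝ :=
      Matrix.of fun i j => A.submatrix Fin.succ Fin.succ i j + 2 * K * (l i * l j) with hA'
    have ih := setLIntegral_gaussWeight_le hQ hK hB hB' h A' fun i j => by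
      have h1 := hA i.succ j.succ
      have h2 : |l i * l j| ≤ B ^ 2 := by
        rw [abs_mul, sq]; exact mul_le_mul (hlB i) (hlB j) (abs_nonneg _) hB
      calc |A' i j| ≤ |A i.succ j.succ| + |2 * K * (l i * l j)| := abs_add_le _ _
        _ ≤ (B - (n + 1 : ℕ) * (2 * K * B ^ 2)) + 2 * K * B ^ 2 := by
            rw [abs_mul (2 * K), abs_of_pos (by positivity : 0 < 2 * K)]
            gcongr
        _ = _ := by push_cast; ring
    rw [← lintegral_indicator (hS _), lintegral_fin_succ
      ((measurable_gaussWeight A).indicator (hS _)), pow_succ', ENNReal.ofReal_mul (by positivity)]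
    calc _ ≤ ∫⁻ x, ENNReal.ofReal (Q * Real.exp (K * B)) *
            {x : Fin n → ℝ | ∀ i, κ < |x i|}.indicator (gaussWeight A') x := by
          refine lintegral_mono fun x => ?_
          simp only
          by_cases hx : x ∈ {x : Fin n → ℝ | ∀ i, κ < |x i|}
          · have e : ∀ z : ℝ, {x : Fin (n + 1) → ℝ | ∀ i, κ < |x i|}.indicator (gaussWeight A)
                (Fin.cons z x) = {z : ℝ | κ < |z|}.indicator
                  (fun z => ENNReal.ofReal (Real.exp ((A 0 0 - 1) / 2 * z ^ 2 +
                    (∑ j, l j * x j) * z)) * gaussWeight (A.submatrix Fin.succ Fin.succ) x) z := by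
              intro z
              have hx' : ∀ i, κ < |x i| := hx
              simp [Set.indicator, Fin.forall_fin_succ, hx', gaussWeight_cons, hl]
            simp only [e]
            rw [lintegral_indicator hS1, lintegral_mul_const _ (by fun_prop),
              Set.indicator_of_mem hx, hA', ← exp_mul_gaussWeight, ← mul_assoc,
              ← ENNReal.ofReal_mul (by positivity), mul_assoc, ← Real.exp_add, ← mul_add]
            gcongr
            refine le_trans (lintegral_mono fun z => ENNReal.ofReal_le_ofReal ?_)
              (h B (∑ j, l j * x j) hB hB')
            gcongr
            exact (abs_le.1 (hAB 0 0)).2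
          · have e : ∀ z : ℝ, {x : Fin (n + 1) → ℝ | ∀ i, κ < |x i|}.indicator (gaussWeight A)
                (Fin.cons z x) = 0 := by
              intro z
              refine Set.indicator_of_notMem (fun hz => hx fun i => ?_) _
              simpa using hz i.succ
            simp [e]
      _ = ENNReal.ofReal (Q * Real.exp (K * B)) *
            ∫⁻ x in {x : Fin n → ℝ | ∀ i, κ < |x i|}, gaussWeight A' x := by
          rw [lintegral_const_mul _ ((measurable_gaussWeight _).indicator (hS _)),
            lintegral_indicator (hS _)]
      _ ≤ _ := mul_le_mul_right ih _

lemma gaussWeight_eq_dotProduct {n : ℕ} (A : Matrix (Fin n) (Fin n) ℝ) (x : Fin n → ℝ) :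
    gaussWeight A x = ENNReal.ofReal (Real.exp (-(x ⬝ᵥ (1 - A) *ᵥ x) / 2)) := by
  unfold gaussWeight
  congr 2
  have e : x ⬝ᵥ A *ᵥ x = ∑ i, ∑ j, A i j * x i * x j := by
    simp only [dotProduct, Matrix.mulVec, Finset.mul_sum]
    exact Finset.sum_congr rfl fun i _ => Finset.sum_congr rfl fun j _ => by ring
  have e' : x ⬝ᵥ x = ∑ i, x i ^ 2 := by simp only [dotProduct, sq]
  rw [Matrix.sub_mulVec, dotProduct_sub, Matrix.one_mulVec, e, e']
  ring

/-- The moment generating function of the Gaussian weight with precision matrix `1 - A`. -/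
lemma lintegral_exp_mul_gaussWeight {n : ℕ} {A S : Matrix (Fin n) (Fin n) ℝ}
    (hA : A.IsSymm) (hAS : (1 - A) * S = 1) (t : Fin n → ℝ) :
    ∫⁻ x, ENNReal.ofReal (Real.exp (t ⬝ᵥ x)) * gaussWeight A x =
      ENNReal.ofReal (Real.exp (t ⬝ᵥ S *ᵥ t / 2)) * ∫⁻ x, gaussWeight A x := by
  have hM : (1 - A)ᵀ = 1 - A := by rw [Matrix.transpose_sub, Matrix.transpose_one, hA.eq]
  have hMa : (1 - A) *ᵥ (S *ᵥ t) = t := by rw [Matrix.mulVec_mulVec, hAS, Matrix.one_mulVec]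
  rw [← lintegral_const_mul _ (measurable_gaussWeight A)]
  conv_rhs => rw [← lintegral_sub_right_eq_self _ (S *ᵥ t)]
  refine lintegral_congr fun x => ?_
  rw [gaussWeight_eq_dotProduct, gaussWeight_eq_dotProduct, ← ENNReal.ofReal_mul (Real.exp_pos _).le,
    ← ENNReal.ofReal_mul (Real.exp_pos _).le, ← Real.exp_add, ← Real.exp_add]
  congr 2
  have h1 : (S *ᵥ t) ⬝ᵥ (1 - A) *ᵥ x = t ⬝ᵥ x := by
    rw [Matrix.dotProduct_mulVec, ← Matrix.mulVec_transpose, hM, hMa]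
  rw [Matrix.mulVec_sub, hMa, sub_dotProduct, dotProduct_sub, dotProduct_sub, h1,
    dotProduct_comm x t, dotProduct_comm (S *ᵥ t) t]
  ring

lemma map_eq_of_mgf_eq {Ω Ω' : Type*} {mΩ : MeasurableSpace Ω} {mΩ' : MeasurableSpace Ω'}
    {μ : Measure Ω} {μ' : Measure Ω'} [IsProbabilityMeasure μ] [IsProbabilityMeasure μ']
    {X : Ω → ℝ} {Y : Ω' → ℝ} (hX : AEMeasurable X μ) (hY : AEMeasurable Y μ')
    (h : mgf X μ = mgf Y μ') (hpos : ∀ t, 0 < mgf X μ t) : μ.map X = μ'.map Y := by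
  refine Measure.ext_of_complexMGF_eq hX hY (funext fun z => ?_)
  have huniv : integrableExpSet X μ = Set.univ :=
    Set.eq_univ_of_forall fun t => mgf_pos_iff.1 (hpos t)
  refine eqOn_complexMGF_of_mgf h ?_
  simp [huniv]

/-- **Cramér–Wold** for finite measures on `ℝⁿ`. -/
lemma measure_eq_of_map_dotProduct_eq {n : ℕ} {μ ν : Measure (Fin n → ℝ)} [IsFiniteMeasure μ]
    [IsFiniteMeasure ν] (h : ∀ t : Fin n → ℝ, μ.map (fun x => t ⬝ᵥ x) = ν.map fun x => t ⬝ᵥ x) :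
    μ = ν := by
  refine Measure.ext_of_charFunDual (funext fun L => ?_)
  have hL : (L : (Fin n → ℝ) → ℝ) = fun x => (fun i => L (Pi.single i 1)) ⬝ᵥ x := by
    funext x
    conv_lhs => rw [← Finset.univ_sum_single x]
    rw [map_sum, dotProduct]
    refine Finset.sum_congr rfl fun i _ => ?_
    rw [show (Pi.single i (x i) : Fin n → ℝ) = x i • Pi.single i (1 : ℝ) by
      rw [← Pi.single_smul, smul_eq_mul, mul_one], map_smul, smul_eq_mul, mul_comm]
  rw [charFunDual_eq_charFun_map_one, charFunDual_eq_charFun_map_one, hL, h]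

/-- The density of a nondegenerate centered Gaussian vector. -/
lemma measure_mul_lintegral_gaussWeight {n : ℕ} {A S : Matrix (Fin n) (Fin n) ℝ}
    (hA : A.IsSymm) (hAS : (1 - A) * S = 1) (hS : ∀ t, 0 ≤ t ⬝ᵥ S *ᵥ t)
    (h0 : ∫⁻ x, gaussWeight A x ≠ 0) (htop : ∫⁻ x, gaussWeight A x ≠ ⊤)
    {μ : Measure (Fin n → ℝ)} [IsProbabilityMeasure μ]
    (hμ : ∀ t : Fin n → ℝ,
      μ.map (fun x => t ⬝ᵥ x) = gaussianReal 0 (Real.toNNReal (t ⬝ᵥ S *ᵥ t)))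
    {s : Set (Fin n → ℝ)} (hs : MeasurableSet s) :
    (∫⁻ x, gaussWeight A x) * μ s = ∫⁻ x in s, gaussWeight A x := by
  set Z := ∫⁻ x, gaussWeight A x with hZ
  set ν : Measure (Fin n → ℝ) := Z⁻¹ • volume.withDensity (gaussWeight A) with hν
  have hprob : IsProbabilityMeasure ν := ⟨by
    rw [hν, Measure.smul_apply, withDensity_apply _ MeasurableSet.univ, setLIntegral_univ, ← hZ,
      smul_eq_mul, ENNReal.inv_mul_cancel h0 htop]⟩
  have hmgf : ∀ t : Fin n → ℝ, ∫⁻ x, ENNReal.ofReal (Real.exp (t ⬝ᵥ x)) ∂ν =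
      ENNReal.ofReal (Real.exp (t ⬝ᵥ S *ᵥ t / 2)) := fun t => by
    have hm : Measurable fun x : Fin n → ℝ => ENNReal.ofReal (Real.exp (t ⬝ᵥ x)) := by
      unfold dotProduct; fun_prop
    rw [hν, lintegral_smul_measure,
      lintegral_withDensity_eq_lintegral_mul _ (measurable_gaussWeight A) hm]
    have e := lintegral_exp_mul_gaussWeight hA hAS t
    simp only [Pi.mul_apply, mul_comm (gaussWeight A _)]
    rw [e, ← hZ, smul_eq_mul, mul_left_comm, ENNReal.inv_mul_cancel h0 htop, mul_one]
  have hμν : μ = ν := by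
    refine measure_eq_of_map_dotProduct_eq fun t => ?_
    have hm : Measurable fun x : Fin n → ℝ => t ⬝ᵥ x := by unfold dotProduct; fun_prop
    refine map_eq_of_mgf_eq hm.aemeasurable hm.aemeasurable (funext fun r => ?_) fun r => ?_
    · rw [mgf_gaussianReal (hμ t), mgf, integral_eq_lintegral_of_nonneg_ae
        (Filter.Eventually.of_forall fun x => (Real.exp_pos _).le)
        (by fun_prop)]
      have e := hmgf (r • t)
      simp only [smul_dotProduct, Matrix.mulVec_smul, dotProduct_smul, smul_eq_mul] at e
      rw [e, ENNReal.toReal_ofReal (Real.exp_pos _).le, Real.coe_toNNReal _ (hS t)]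
      congr 1
      ring
    · rw [mgf_gaussianReal (hμ t)]
      exact Real.exp_pos _
  rw [hμν, hν, Measure.smul_apply, withDensity_apply _ hs, smul_eq_mul, ← mul_assoc,
    ENNReal.mul_inv_cancel h0 htop, one_mul]

lemma dotProduct_mulVec_nonneg_of_abs_le {n : ℕ} {S : Matrix (Fin n) (Fin n) ℝ} {c : ℝ}
    (hc : c ≤ 1) (hn : 0 < n) (hdiag : ∀ i, S i i = 1) (hoff : ∀ i j, i ≠ j → |S i j| ≤ c / n)
    (t : Fin n → ℝ) : 0 ≤ t ⬝ᵥ S *ᵥ t := by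
  have hn' : (0 : ℝ) < n := by exact_mod_cast hn
  have h : ∀ i j, (if i = j then t i ^ 2 else 0) - 1 / n * ((t i ^ 2 + t j ^ 2) / 2) ≤
      t i * (S i j * t j) := by
    intro i j
    have hp : 0 ≤ (1 : ℝ) / n * ((t i ^ 2 + t j ^ 2) / 2) := by positivity
    split_ifs with hij
    · subst hij
      rw [hdiag]
      nlinarith
    · have h1 : |S i j| ≤ 1 / n := (hoff i j hij).trans (by gcongr)
      have h2 : |t i * t j| ≤ (t i ^ 2 + t j ^ 2) / 2 := by
        rw [abs_le]
        constructor <;> nlinarith [sq_nonneg (t i + t j), sq_nonneg (t i - t j)]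
      have h3 : |S i j * (t i * t j)| ≤ 1 / n * ((t i ^ 2 + t j ^ 2) / 2) := by
        rw [abs_mul]; gcongr
      have h4 := (abs_le.1 h3).1
      linarith
  calc (0 : ℝ) = ∑ i, ∑ j, ((if i = j then t i ^ 2 else 0) -
        1 / n * ((t i ^ 2 + t j ^ 2) / 2)) := by
        simp only [Finset.sum_sub_distrib, ← Finset.mul_sum, ← Finset.sum_div,
          Finset.sum_add_distrib, Finset.sum_ite_eq, Finset.mem_univ, if_true, Finset.sum_const,
          Finset.card_univ, Fintype.card_fin, nsmul_eq_mul]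
        field_simp
        ring
    _ ≤ ∑ i, ∑ j, t i * (S i j * t j) :=
        Finset.sum_le_sum fun i _ => Finset.sum_le_sum fun j _ => h i j
    _ = _ := by simp only [dotProduct, Matrix.mulVec, Finset.mul_sum]

/-- A small entrywise perturbation of the identity has an inverse of the same kind. -/
lemma exists_inverse_of_abs_le {n : ℕ} {S : Matrix (Fin n) (Fin n) ℝ} {c : ℝ}
    (hc0 : 0 ≤ c) (hc : c ≤ 1 / 2) (hn : 0 < n) (hsymm : S.IsSymm) (hdiag : ∀ i, S i i = 1)
    (hoff : ∀ i j, i ≠ j → |S i j| ≤ c / n) :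
    ∃ A : Matrix (Fin n) (Fin n) ℝ, A.IsSymm ∧ (1 - A) * S = 1 ∧ ∀ i j, |A i j| ≤ 2 * c / n := by
  have hn' : (0 : ℝ) < n := by exact_mod_cast hn
  have : Nonempty (Fin n) := ⟨⟨0, hn⟩⟩
  have hdet : S.det ≠ 0 := by
    refine det_ne_zero_of_sum_row_lt_diag fun k => ?_
    rw [hdiag, norm_one]
    calc ∑ j ∈ Finset.univ.erase k, ‖S k j‖ ≤ ∑ j ∈ Finset.univ.erase k, c / n :=
          Finset.sum_le_sum fun j hj => hoff k j (Finset.ne_of_mem_erase hj).symm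
      _ ≤ ∑ _j : Fin n, c / n :=
          Finset.sum_le_sum_of_subset_of_nonneg (Finset.erase_subset _ _)
            fun _ _ _ => by positivity
      _ = c := by
          simp only [Finset.sum_const, Finset.card_univ, Fintype.card_fin, nsmul_eq_mul]
          field_simp
      _ < 1 := by linarith
  have hunit : IsUnit S.det := isUnit_iff_ne_zero.2 hdet
  refine ⟨1 - S⁻¹, ?_, ?_, ?_⟩
  · rw [Matrix.IsSymm, Matrix.transpose_sub, Matrix.transpose_one, Matrix.transpose_nonsing_inv,
      hsymm.eq]
  · rw [sub_sub_cancel, Matrix.nonsing_inv_mul _ hunit]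
  · set A := 1 - S⁻¹ with hA
    have hE : ∀ i j, |(S - 1) i j| ≤ c / n := fun i j => by
      rcases eq_or_ne i j with rfl | hij
      · simp only [Matrix.sub_apply, Matrix.one_apply_eq, hdiag, sub_self, abs_zero]
        positivity
      · simpa [Matrix.sub_apply, Matrix.one_apply_ne hij] using hoff i j hij
    have hAE : A = (S - 1) - (S - 1) * A := by
      rw [hA, mul_sub, mul_one, sub_mul, Matrix.mul_nonsing_inv _ hunit, one_mul]
      abel
    obtain ⟨p, -, hp⟩ := Finset.exists_max_image Finset.univ
      (fun p : Fin n × Fin n => |A p.1 p.2|) Finset.univ_nonempty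
    have hmax : ∀ i j, |A i j| ≤ |A p.1 p.2| := fun i j => hp (i, j) (Finset.mem_univ _)
    have hbound : |A p.1 p.2| ≤ c / n + c * |A p.1 p.2| := by
      calc |A p.1 p.2| = |(S - 1) p.1 p.2 - ∑ k, (S - 1) p.1 k * A k p.2| := by
            conv_lhs => rw [hAE]
            rw [Matrix.sub_apply, Matrix.mul_apply]
        _ ≤ |(S - 1) p.1 p.2| + |∑ k, (S - 1) p.1 k * A k p.2| := abs_sub _ _
        _ ≤ c / n + ∑ _k : Fin n, c / n * |A p.1 p.2| := by
            refine add_le_add (hE _ _) ((Finset.abs_sum_le_sum_abs _ _).trans ?_)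
            refine Finset.sum_le_sum fun k _ => ?_
            rw [abs_mul]
            exact mul_le_mul (hE _ _) (hmax _ _) (abs_nonneg _) (by positivity)
        _ = _ := by
            simp only [Finset.sum_const, Finset.card_univ, Fintype.card_fin, nsmul_eq_mul]
            field_simp
    intro i j
    refine (hmax i j).trans ?_
    have := mul_le_mul_of_nonneg_right hc (abs_nonneg (A p.1 p.2))
    rw [mul_div_assoc]
    linarith

lemma setLIntegral_exp_eq (κ : ℝ) :
    ∫⁻ z in {z : ℝ | κ < |z|}, ENNReal.ofReal (Real.exp (-(1 / 2) * z ^ 2)) =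
      ENNReal.ofReal (√(2 * Real.pi) * (gaussianReal 0 1 {z | κ < |z|}).toReal) := by
  rw [ENNReal.ofReal_mul (by positivity), ENNReal.ofReal_toReal (measure_ne_top _ _),
    gaussianReal_apply _ one_ne_zero, ← lintegral_const_mul _ (measurable_gaussianPDF _ _)]
  refine lintegral_congr fun z => ?_
  rw [gaussianPDF, gaussianPDFReal, ← ENNReal.ofReal_mul (by positivity), NNReal.coe_one, mul_one,
    ← mul_assoc, mul_inv_cancel₀ (by positivity), one_mul]
  congr 2
  ring

lemma gaussianReal_lt_abs_pos (κ : ℝ) : 0 < (gaussianReal 0 1 {z | κ < |z|}).toReal := by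
  refine ENNReal.toReal_pos (fun h => ?_) (measure_ne_top _ _)
  have hopen : IsOpen {z : ℝ | κ < |z|} := isOpen_lt continuous_const continuous_abs
  refine hopen.measure_ne_zero volume ⟨|κ| + 1, ?_⟩
    (gaussianReal_absolutelyContinuous' 0 one_ne_zero h)
  have := le_abs_self κ
  have := le_abs_self (|κ| + 1)
  simp only [Set.mem_ofPred_eq]
  linarith

theorem stmt10 (κ : ℝ) (hκ : 0 < κ) :
    ∃ cκ > (0:ℝ), ∃ C > (0:ℝ), ∀ m : ℕ, 0 < m →
      ∀ (μ : Measure (Fin m → ℝ)) (Cov : Matrix (Fin m) (Fin m) ℝ),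
        IsCenteredGaussianVec μ Cov → (∀ i, Cov i i = 1) →
        (∀ i j, i ≠ j → |Cov i j| ≤ cκ / m) →
        (μ {x | ∀ i, κ < |x i|}).toReal ≤
          C * ((gaussianReal 0 1 {z | κ < |z|}).toReal) ^ m := by
  have hq := gaussianReal_lt_abs_pos κ
  have hq' := gaussianReal_lt_abs_pos (-1)
  set q := (gaussianReal 0 1 {z | κ < |z|}).toReal
  set q' := (gaussianReal 0 1 {z | (-1 : ℝ) < |z|}).toReal
  obtain ⟨K, hK, hKb⟩ := exists_setLIntegral_exp_le κ (√(2 * Real.pi) * q) (by positivity)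
    (setLIntegral_exp_eq κ)
  obtain ⟨K', hK', hKb'⟩ := exists_setLIntegral_exp_le (-1) (√(2 * Real.pi) * q') (by positivity)
    (setLIntegral_exp_eq (-1))
  have hc : 0 < 1 / (16 * (1 + K + K')) := by positivity
  have hcmul : 1 / (16 * (1 + K + K')) * (16 * (1 + K + K')) = 1 :=
    one_div_mul_cancel (by positivity)
  set c := 1 / (16 * (1 + K + K'))
  have hcK : 0 < c * K := by positivity
  have hcK' : 0 < c * K' := by positivity
  refine ⟨c, hc, Real.exp ((K + 1 / 2) * (4 * c)), Real.exp_pos _, ?_⟩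
  intro m hm μ Cov hμ hdiag hoff
  have hm' : (0 : ℝ) < m := by exact_mod_cast hm
  have hm1 : (1 : ℝ) ≤ m := by exact_mod_cast hm
  have := hμ.1
  set S : Matrix (Fin m) (Fin m) ℝ := Matrix.of fun i j => (Cov i j + Cov j i) / 2 with hSdef
  have hSsymm : S.IsSymm := Matrix.IsSymm.ext fun i j => by simp [hSdef, add_comm]
  have hSdiag : ∀ i, S i i = 1 := fun i => by simp [hSdef, hdiag]
  have hSoff : ∀ i j, i ≠ j → |S i j| ≤ c / m := fun i j hij => by
    have h1 := abs_le.1 (hoff i j hij)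
    have h2 := abs_le.1 (hoff j i hij.symm)
    rw [abs_le]
    constructor <;> simp only [hSdef, Matrix.of_apply] <;> linarith
  have hquad : ∀ t : Fin m → ℝ, ∑ i, ∑ j, t i * Cov i j * t j = t ⬝ᵥ S *ᵥ t := fun t => by
    have e : t ⬝ᵥ S *ᵥ t =
        (∑ i, ∑ j, t i * Cov i j * t j) / 2 + (∑ i, ∑ j, t j * Cov j i * t i) / 2 := by
      simp only [dotProduct, Matrix.mulVec, Finset.mul_sum, Finset.sum_div,
        ← Finset.sum_add_distrib]
      refine Finset.sum_congr rfl fun i _ => Finset.sum_congr rfl fun j _ => ?_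
      simp only [hSdef, Matrix.of_apply]
      ring
    rw [e, Finset.sum_comm (f := fun i j => t j * Cov j i * t i), add_halves]
  obtain ⟨A, hAsymm, hAS, hAb⟩ :=
    exists_inverse_of_abs_le hc.le (by nlinarith) hm hSsymm hSdiag hSoff
  have hB0 : 0 ≤ 4 * c / m := by positivity
  have hB1 : 4 * c / m ≤ 1 / 4 := by
    rw [div_le_iff₀ hm']; nlinarith
  have hBm : 4 * c / m * m = 4 * c := div_mul_cancel₀ _ hm'.ne'
  have hAB : ∀ L : ℝ, 16 * (c * L) ≤ 1 →
      ∀ i j, |A i j| ≤ 4 * c / m - m * (2 * L * (4 * c / m) ^ 2) := fun L hL i j => by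
    refine (hAb i j).trans ?_
    have e : 4 * c / m - m * (2 * L * (4 * c / m) ^ 2) = 2 * c / m * (2 - 16 * (c * L)) := by
      field_simp
      ring
    rw [e]
    exact le_mul_of_one_le_right (by positivity) (by linarith)
  have hlow := le_lintegral_gaussWeight hB0 A fun i =>
    (abs_le.1 ((hAb i i).trans (by gcongr; norm_num : 2 * c / m ≤ 4 * c / m))).1
  have hup := setLIntegral_gaussWeight_le (by positivity) hK hB0 hB1 hKb A
    (hAB K (by nlinarith))
  have htop := setLIntegral_gaussWeight_le (by positivity) hK' hB0 hB1 hKb' A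
    (hAB K' (by nlinarith))
  have huniv : {x : Fin m → ℝ | ∀ i, (-1 : ℝ) < |x i|} = Set.univ :=
    Set.eq_univ_of_forall fun x i => lt_of_lt_of_le (by norm_num) (abs_nonneg (x i))
  rw [huniv, setLIntegral_univ] at htop
  have hmeas : MeasurableSet {x : Fin m → ℝ | ∀ i, κ < |x i|} := by
    simp only [Set.ofPred_forall]
    exact MeasurableSet.iInter fun i => measurableSet_lt (by fun_prop) (by fun_prop)
  have hdens := measure_mul_lintegral_gaussWeight hAsymm hAS
    (dotProduct_mulVec_nonneg_of_abs_le (by nlinarith) hm hSdiag hSoff)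
    (ne_of_gt (lt_of_lt_of_le (ENNReal.ofReal_pos.2 (by positivity)) hlow))
    (ne_top_of_le_ne_top ENNReal.ofReal_ne_top htop)
    (fun t => by rw [← hquad]; exact hμ.2 t) hmeas
  have hmain := (mul_le_mul_left hlow (μ {x | ∀ i, κ < |x i|})).trans (hdens.le.trans hup)
  have hreal := ENNReal.toReal_mono ENNReal.ofReal_ne_top hmain
  rw [ENNReal.toReal_mul, ENNReal.toReal_ofReal (by positivity),
    ENNReal.toReal_ofReal (by positivity)] at hreal
  refine le_of_mul_le_mul_left (hreal.trans_eq ?_)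
    (by positivity : 0 < (√(2 * Real.pi) * Real.exp (-(4 * c / m) / 2)) ^ m)
  have e : Real.exp ((K + 1 / 2) * (4 * c)) = Real.exp ((K + 1 / 2) * (4 * c / m)) ^ m := by
    rw [← Real.exp_nat_mul]
    congr 1
    linear_combination (-(K + 1 / 2)) * hBm
  rw [e, ← mul_pow, ← mul_pow]
  congr 1
  calc √(2 * Real.pi) * q * Real.exp (K * (4 * c / m))
      = √(2 * Real.pi) * q *
        (Real.exp (-(4 * c / m) / 2) * Real.exp ((K + 1 / 2) * (4 * c / m))) := by
        rw [← Real.exp_add]; ring_nf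
    _ = _ := by ring

end
end
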